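/- Let μ be a finite Borel measure supported on a ball B' ⊂ ℝ^d. Let B ⊂ ℝ^d be a ball with 3B ⊂ B', C⁻¹r(B') ≤ r(B) ≤ r(B'), and C⁻¹r(B)ⁿ ≤ μ(B) ≤ μ(B') ≤ C·r(B)ⁿ. Let L be an affine n-plane intersecting B and let f : L → [0,1] be a function equal to 1 identically on 3B ∩ L, vanishing on L∖B', and with ∫f dℋⁿ⌊L = μ(B'). Then W₂(φ_B μ, c·φ_B ℋⁿ⌊L) ≤ C'·W₂(μ, f·ℋⁿ⌊L), where c = (∫φ_B dμ)/(∫φ_B dℋⁿ⌊L) and C' depends only on n, d, C and the constant c₂ of the bump function φ. -/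

import Mathlib

open MeasureTheory Metric Set ENNReal
open scoped NNReal

noncomputable section

/-- The `p`-th Wasserstein distance between two measures, as a value in `ℝ≥0∞`. -/
def Wp {E : Type*} [EMetricSpace E] [MeasurableSpace E] (p : ℝ) (μ ν : Measure E) : ℝ≥0∞ :=
  ⨅ π ∈ {π : Measure (E × E) | π.map Prod.fst = μ ∧ π.map Prod.snd = ν},
    (∫⁻ z, edist z.1 z.2 ^ p ∂π) ^ (1 / p)

/-- The (closed) support of a measure: points all of whose neighbourhoods have
positive measure. -/
def msupp {E : Type*} [MeasurableSpace E] [PseudoMetricSpace E] (μ : Measure E) : Set E :=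
  {x | ∀ ε : ℝ, 0 < ε → 0 < μ (ball x ε)}

/-- `μ` is an `n`-dimensional Ahlfors-David regular measure with constant `c₀`:
`c₀⁻¹ rⁿ ≤ μ(B(x,r)) ≤ c₀ rⁿ` for `x ∈ supp μ` and `0 < r ≤ diam(supp μ)`. -/
def ADRegular {d : ℕ} (n : ℕ) (c₀ : ℝ) (μ : Measure (EuclideanSpace ℝ (Fin d))) : Prop :=
  ∀ x ∈ msupp μ, ∀ r : ℝ, 0 < r → ENNReal.ofReal r ≤ EMetric.diam (msupp μ) →
    ENNReal.ofReal (c₀⁻¹ * r ^ n) ≤ μ (closedBall x r) ∧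
      μ (closedBall x r) ≤ ENNReal.ofReal (c₀ * r ^ n)

/-- `μ` is uniformly `n`-rectifiable: `μ` has big pieces of Lipschitz images of `ℝⁿ`, i.e.
there are `θ, M > 0` so that for each `x ∈ supp μ` and `0 < r ≤ diam (supp μ)` there is an
`M`-Lipschitz map `g : ℝⁿ → ℝ^d` with `μ(B(x,r) ∩ g(Bₙ(0,r))) ≥ θ rⁿ`. -/
def UnifRectifiable {d : ℕ} (n : ℕ) (μ : Measure (EuclideanSpace ℝ (Fin d))) : Prop :=
  ∃ θ M : ℝ, 0 < θ ∧ 0 < M ∧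
    ∀ x ∈ msupp μ, ∀ r : ℝ, 0 < r → ENNReal.ofReal r ≤ EMetric.diam (msupp μ) →
      ∃ g : EuclideanSpace ℝ (Fin n) → EuclideanSpace ℝ (Fin d),
        LipschitzWith (Real.toNNReal M) g ∧
        ENNReal.ofReal (θ * r ^ n) ≤ μ (closedBall x r ∩ g '' (closedBall 0 r))

/-- `φ` is an admissible radial bump function with constant `c₂`:
`φ : ℝ^d → [0,1]` is radial, Lipschitz, `χ_{B(0,2)} ≤ φ ≤ χ_{B(0,3)}`,
`c₂⁻¹ dist(x,∂B(0,3))² ≤ φ(x) ≤ c₂ dist(x,∂B(0,3))²` and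
`|∇φ(x)| ≤ c₂ dist(x,∂B(0,3))` on `B(0,3)`. -/
def IsBump {d : ℕ} (c₂ : ℝ) (φ : EuclideanSpace ℝ (Fin d) → ℝ) : Prop :=
  (∃ K : ℝ≥0, LipschitzWith K φ) ∧
  (∀ x y : EuclideanSpace ℝ (Fin d), ‖x‖ = ‖y‖ → φ x = φ y) ∧
  (∀ x, φ x ∈ Icc (0:ℝ) 1) ∧
  (∀ x : EuclideanSpace ℝ (Fin d), ‖x‖ ≤ 2 → φ x = 1) ∧
  (∀ x : EuclideanSpace ℝ (Fin d), 3 ≤ ‖x‖ → φ x = 0) ∧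
  (∀ x : EuclideanSpace ℝ (Fin d), ‖x‖ < 3 →
    c₂⁻¹ * (3 - ‖x‖) ^ 2 ≤ φ x ∧ φ x ≤ c₂ * (3 - ‖x‖) ^ 2) ∧
  (∀ x : EuclideanSpace ℝ (Fin d), ‖x‖ < 3 → DifferentiableAt ℝ φ x →
    ‖fderiv ℝ φ x‖ ≤ c₂ * (3 - ‖x‖))

/-- The rescaled bump `φ_B` adapted to the ball `B = B(x,r)`: `φ_B(y) = φ((y-x)/r)`. -/
def phiB {d : ℕ} (φ : EuclideanSpace ℝ (Fin d) → ℝ) (x : EuclideanSpace ℝ (Fin d)) (r : ℝ)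
    (y : EuclideanSpace ℝ (Fin d)) : ℝ :=
  φ (r⁻¹ • (y - x))

/-- The normalizing constant `c_{B,L} = (∫φ_B dμ)/(∫φ_B dℋⁿ⌊L)`. -/
def cBL {d : ℕ} (n : ℕ) (φ : EuclideanSpace ℝ (Fin d) → ℝ)
    (μ : Measure (EuclideanSpace ℝ (Fin d))) (x : EuclideanSpace ℝ (Fin d)) (r : ℝ)
    (L : AffineSubspace ℝ (EuclideanSpace ℝ (Fin d))) : ℝ :=
  (∫ y, phiB φ x r y ∂μ) /
    (∫ y, phiB φ x r y ∂((μH[(n:ℝ)]).restrict (L : Set (EuclideanSpace ℝ (Fin d)))))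

/-- The flat measure `c_{B,L} φ_B ℋⁿ⌊L` against which `φ_B μ` is compared. -/
def flatB {d : ℕ} (n : ℕ) (φ : EuclideanSpace ℝ (Fin d) → ℝ)
    (μ : Measure (EuclideanSpace ℝ (Fin d))) (x : EuclideanSpace ℝ (Fin d)) (r : ℝ)
    (L : AffineSubspace ℝ (EuclideanSpace ℝ (Fin d))) :
    Measure (EuclideanSpace ℝ (Fin d)) :=
  ENNReal.ofReal (cBL n φ μ x r L) •
    ((μH[(n:ℝ)]).restrict (L : Set (EuclideanSpace ℝ (Fin d)))).withDensity
      (fun y => ENNReal.ofReal (phiB φ x r y))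

/-- The coefficient `α_p(B(x,r))` of the measure `μ` (with respect to the bump `φ`):
`α_p(B) = r^{-1-n/p} inf_L W_p(φ_B μ, c_{B,L} φ_B ℋⁿ⌊L)`, the infimum over all affine
`n`-planes `L` intersecting `B`. -/
def alphaP {d : ℕ} (n : ℕ) (p : ℝ) (φ : EuclideanSpace ℝ (Fin d) → ℝ)
    (μ : Measure (EuclideanSpace ℝ (Fin d))) (x : EuclideanSpace ℝ (Fin d)) (r : ℝ) :
    ℝ≥0∞ :=
  ENNReal.ofReal (r ^ (-(1:ℝ) - n / p)) *
    ⨅ L ∈ {L : AffineSubspace ℝ (EuclideanSpace ℝ (Fin d)) |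
        Module.finrank ℝ L.direction = n ∧
          ((L : Set (EuclideanSpace ℝ (Fin d))) ∩ closedBall x r).Nonempty},
      Wp p (μ.withDensity fun y => ENNReal.ofReal (phiB φ x r y)) (flatB n φ μ x r L)

/-- The coefficient `β_p(B(x,r))` of the measure `μ` for `p = 2`:
`β₂(B)² = inf_L r^{-n} ∫_{2B} (dist(y,L)/r)² dμ(y)`, over all affine `n`-planes `L`. -/
def beta2 {d : ℕ} (n : ℕ) (μ : Measure (EuclideanSpace ℝ (Fin d)))
    (x : EuclideanSpace ℝ (Fin d)) (r : ℝ) : ℝ≥0∞ :=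
  ⨅ L ∈ {L : AffineSubspace ℝ (EuclideanSpace ℝ (Fin d)) |
      Module.finrank ℝ L.direction = n},
    ((∫⁻ y in closedBall x (2 * r),
        ENNReal.ofReal ((infDist y (L : Set (EuclideanSpace ℝ (Fin d))) / r) ^ 2) ∂μ) /
      ENNReal.ofReal (r ^ n)) ^ (1/2 : ℝ)

/-- `dist_B(σ,ν)`: the supremum of `|∫f dσ − ∫f dν|` over `1`-Lipschitz functions `f`
supported in `B`. -/
def distB {d : ℕ} (B : Set (EuclideanSpace ℝ (Fin d)))
    (σ ν : Measure (EuclideanSpace ℝ (Fin d))) : ℝ≥0∞ :=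
  ⨆ f ∈ {f : EuclideanSpace ℝ (Fin d) → ℝ | LipschitzWith 1 f ∧ ∀ x ∉ B, f x = 0},
    ENNReal.ofReal |(∫ x, f x ∂σ) - (∫ x, f x ∂ν)|

/-- The coefficient `α(B(x,r))` of `[Tolsa, PLMS]`:
`α(B) = r^{-n-1} inf_{a ≥ 0, L} dist_{3B}(μ, a ℋⁿ⌊L)`. -/
def alphaCoef {d : ℕ} (n : ℕ) (μ : Measure (EuclideanSpace ℝ (Fin d)))
    (x : EuclideanSpace ℝ (Fin d)) (r : ℝ) : ℝ≥0∞ :=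
  ENNReal.ofReal (r ^ (-(n:ℝ) - 1)) *
    ⨅ (a : ℝ≥0) (L : {L : AffineSubspace ℝ (EuclideanSpace ℝ (Fin d)) //
        Module.finrank ℝ L.direction = n}),
      distB (closedBall x (3 * r)) μ
        ((a : ℝ≥0∞) • (μH[(n:ℝ)]).restrict ((L.1 : Set (EuclideanSpace ℝ (Fin d)))))

section Couplings

variable {X : Type*} [MeasurableSpace X]

/-- `π` is a transport plan from `μ` to `ν`. -/
structure IsCoupling (π : Measure (X × X)) (μ ν : Measure X) : Prop where
  fst : π.map Prod.fst = μ
  snd : π.map Prod.snd = ν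

namespace IsCoupling

variable {π π' : Measure (X × X)} {μ ν μ' ν' : Measure X}

theorem swap (h : IsCoupling π μ ν) : IsCoupling (π.map Prod.swap) ν μ where
  fst := by
    rw [Measure.map_map measurable_fst measurable_swap]
    exact h.snd
  snd := by
    rw [Measure.map_map measurable_snd measurable_swap]
    exact h.fst

theorem add (h : IsCoupling π μ ν) (h' : IsCoupling π' μ' ν') :
    IsCoupling (π + π') (μ + μ') (ν + ν') where
  fst := by rw [Measure.map_add _ _ measurable_fst, h.fst, h'.fst]
  snd := by rw [Measure.map_add _ _ measurable_snd, h.snd, h'.snd]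

theorem smul (h : IsCoupling π μ ν) (c : ℝ≥0∞) : IsCoupling (c • π) (c • μ) (c • ν) where
  fst := by rw [Measure.map_smul, h.fst]
  snd := by rw [Measure.map_smul, h.snd]

theorem lintegral_fst (h : IsCoupling π μ ν) {g : X → ℝ≥0∞} (hg : Measurable g) :
    ∫⁻ z, g z.1 ∂π = ∫⁻ x, g x ∂μ := by
  rw [← h.fst, lintegral_map hg measurable_fst]

theorem lintegral_snd (h : IsCoupling π μ ν) {g : X → ℝ≥0∞} (hg : Measurable g) :
    ∫⁻ z, g z.2 ∂π = ∫⁻ x, g x ∂ν := by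
  rw [← h.snd, lintegral_map hg measurable_snd]

theorem isFiniteMeasure (h : IsCoupling π μ ν) [IsFiniteMeasure μ] : IsFiniteMeasure π := by
  have : IsFiniteMeasure (π.map Prod.fst) := by rw [h.fst]; infer_instance
  exact Measure.isFiniteMeasure_of_map measurable_fst.aemeasurable

theorem ae_mem (h : IsCoupling π μ ν) {s : Set X} (hs : MeasurableSet s) (hμ : μ sᶜ = 0)
    (hν : ν sᶜ = 0) : ∀ᵐ z ∂π, z.1 ∈ s ∧ z.2 ∈ s := by
  rw [← h.fst, Measure.map_apply measurable_fst hs.compl] at hμ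
  rw [← h.snd, Measure.map_apply measurable_snd hs.compl] at hν
  filter_upwards [measure_eq_zero_iff_ae_notMem.1 hμ, measure_eq_zero_iff_ae_notMem.1 hν]
    with z h1 h2
  exact ⟨not_not.1 h1, not_not.1 h2⟩

theorem diag (μ : Measure X) : IsCoupling (μ.map fun x => (x, x)) μ μ where
  fst := by
    rw [Measure.map_map measurable_fst (by fun_prop)]
    exact Measure.map_id
  snd := by
    rw [Measure.map_map measurable_snd (by fun_prop)]
    exact Measure.map_id

theorem normalized_prod (μ ν : Measure X) [IsFiniteMeasure μ] [IsFiniteMeasure ν]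
    (h : μ univ = ν univ) (h0 : μ univ ≠ 0) :
    IsCoupling ((μ univ)⁻¹ • μ.prod ν) μ ν where
  fst := by
    rw [Measure.map_smul, Measure.map_fst_prod, smul_smul, ← h,
      ENNReal.inv_mul_cancel h0 (measure_ne_top _ _), one_smul]
  snd := by
    rw [Measure.map_smul, Measure.map_snd_prod, smul_smul,
      ENNReal.inv_mul_cancel h0 (measure_ne_top _ _), one_smul]

end IsCoupling

end Couplings

theorem edist_sq_le {X : Type*} [PseudoEMetricSpace X] (x y z : X) :
    edist x z ^ 2 ≤ 3 / 2 * edist x y ^ 2 + 3 * edist y z ^ 2 := by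
  have h := edist_triangle x y z
  rcases eq_or_ne (edist x y) ∞ with h1 | h1
  · simp [h1, ENNReal.mul_top, ENNReal.div_eq_zero_iff]
  rcases eq_or_ne (edist y z) ∞ with h2 | h2
  · simp [h2]
  refine (pow_le_pow_left₀ zero_le h 2).trans ?_
  lift edist x y to ℝ≥0 using h1 with a
  lift edist y z to ℝ≥0 using h2 with b
  have : (3 / 2 : ℝ≥0∞) = ((3 / 2 : ℝ≥0) : ℝ≥0∞) := by
    rw [ENNReal.coe_div (by norm_num)]; norm_num
  rw [this]
  have h3 : (a + b) ^ 2 ≤ 3 / 2 * a ^ 2 + 3 * b ^ 2 := by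
    rw [← NNReal.coe_le_coe]
    push_cast
    nlinarith [sq_nonneg ((a : ℝ) - 2 * b)]
  exact_mod_cast h3

section SquaredDistance

variable {X : Type*} [MeasurableSpace X] [PseudoEMetricSpace X]

/-- The quadratic cost of a transport plan. -/
def sqCost (π : Measure (X × X)) : ℝ≥0∞ := ∫⁻ z, edist z.1 z.2 ^ 2 ∂π

/-- The square of the quadratic Wasserstein distance. -/
def W2sq (μ ν : Measure X) : ℝ≥0∞ :=
  ⨅ π ∈ {π : Measure (X × X) | IsCoupling π μ ν}, sqCost π

theorem W2sq_le {π : Measure (X × X)} {μ ν : Measure X} (h : IsCoupling π μ ν) :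
    W2sq μ ν ≤ sqCost π :=
  iInf₂_le π h

theorem sqCost_add (π π' : Measure (X × X)) : sqCost (π + π') = sqCost π + sqCost π' :=
  lintegral_add_measure _ _ _

theorem sqCost_smul (c : ℝ≥0∞) (π : Measure (X × X)) : sqCost (c • π) = c * sqCost π :=
  lintegral_smul_measure _ _

theorem W2sq_smul_le (c : ℝ≥0∞) (hc : c ≠ 0) (hc' : c ≠ ∞) (μ ν : Measure X) :
    W2sq (c • μ) (c • ν) ≤ c * W2sq μ ν := by
  unfold W2sq
  simp_rw [ENNReal.mul_iInf_of_ne hc hc']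
  refine le_iInf₂ fun π hπ => ?_
  rw [← sqCost_smul]
  exact W2sq_le (IsCoupling.smul hπ c)

theorem W2sq_add_le (μ ν μ' ν' : Measure X) :
    W2sq (μ + μ') (ν + ν') ≤ W2sq μ ν + W2sq μ' ν' := by
  unfold W2sq
  simp_rw [ENNReal.iInf_add, ENNReal.add_iInf]
  refine le_iInf₂ fun π hπ => le_iInf₂ fun π' hπ' => ?_
  rw [← sqCost_add]
  exact W2sq_le (IsCoupling.add hπ hπ')

variable [OpensMeasurableSpace X] [SecondCountableTopology X]

theorem measurable_edist_sq : Measurable fun z : X × X => edist z.1 z.2 ^ 2 :=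
  (measurable_fst.edist measurable_snd).pow_const 2

theorem W2sq_comm (μ ν : Measure X) : W2sq μ ν = W2sq ν μ := by
  have key : ∀ μ ν : Measure X, W2sq μ ν ≤ W2sq ν μ := by
    refine fun μ ν => le_iInf₂ fun π hπ => (W2sq_le (IsCoupling.swap hπ)).trans_eq ?_
    rw [sqCost, lintegral_map measurable_edist_sq measurable_swap]
    simp [sqCost, edist_comm]
  exact le_antisymm (key _ _) (key _ _)

theorem W2sq_self (μ : Measure X) : W2sq μ μ = 0 := by
  refine nonpos_iff_eq_zero.1 ((W2sq_le (IsCoupling.diag μ)).trans_eq ?_)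
  rw [sqCost, lintegral_map measurable_edist_sq (by fun_prop)]
  simp

theorem W2sq_add_right_le (μ ν e : Measure X) : W2sq (μ + e) (ν + e) ≤ W2sq μ ν := by
  simpa [W2sq_self] using W2sq_add_le μ ν e e

theorem W2sq_le_of_bounded (μ ν : Measure X) [IsFiniteMeasure μ] [IsFiniteMeasure ν]
    (h : μ univ = ν univ) {s : Set X} (hs : MeasurableSet s) {D : ℝ≥0∞}
    (hD : ∀ x ∈ s, ∀ y ∈ s, edist x y ≤ D) (hμ : μ sᶜ = 0) (hν : ν sᶜ = 0) :
    W2sq μ ν ≤ D ^ 2 * μ univ := by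
  rcases eq_or_ne (μ univ) 0 with h0 | h0
  · rw [h0, eq_comm, Measure.measure_univ_eq_zero] at h
    rw [Measure.measure_univ_eq_zero] at h0
    simp [h, h0, W2sq_self]
  have hc := IsCoupling.normalized_prod μ ν h h0
  refine (W2sq_le hc).trans ?_
  have hae := hc.ae_mem hs hμ hν
  calc sqCost _ ≤ ∫⁻ _, D ^ 2 ∂((μ univ)⁻¹ • μ.prod ν) := by
        refine lintegral_mono_ae ?_
        filter_upwards [hae] with z hz
        gcongr
        exact hD _ hz.1 _ hz.2
    _ = D ^ 2 * μ univ := by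
        rw [lintegral_const]
        have := hc.lintegral_fst (g := 1) measurable_const
        simp only [Pi.one_apply, lintegral_one] at this
        rw [this]

theorem W2sq_withDensity_le (π : Measure (X × X)) {ρ : X × X → ℝ≥0∞} (hρ : Measurable ρ) :
    W2sq ((π.withDensity ρ).map Prod.fst) ((π.withDensity ρ).map Prod.snd) ≤
      ∫⁻ z, ρ z * edist z.1 z.2 ^ 2 ∂π := by
  refine (W2sq_le ⟨rfl, rfl⟩).trans_eq ?_
  rw [sqCost, lintegral_withDensity_eq_lintegral_mul _ hρ measurable_edist_sq]
  rfl

open ProbabilityTheory in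
theorem W2sq_triangle [StandardBorelSpace X] [Nonempty X] (μ ν ρ : Measure X)
    [IsFiniteMeasure μ] [IsFiniteMeasure ν] :
    W2sq μ ρ ≤ 3 / 2 * W2sq μ ν + 3 * W2sq ν ρ := by
  have h32 : (3 / 2 : ℝ≥0∞) ≠ ∞ := (ENNReal.div_lt_top (by norm_num) (by norm_num)).ne
  have h32' : (3 / 2 : ℝ≥0∞) ≠ 0 := by simp
  conv_rhs => unfold W2sq
  simp_rw [ENNReal.mul_iInf_of_ne h32' h32,
    ENNReal.mul_iInf_of_ne (show (3 : ℝ≥0∞) ≠ 0 by norm_num) (show (3 : ℝ≥0∞) ≠ ∞ by norm_num),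
    ENNReal.iInf_add, ENNReal.add_iInf]
  refine le_iInf₂ fun π₁ h₁ => le_iInf₂ fun π₂ h₂ => ?_
  have h₁ : IsCoupling π₁ μ ν := h₁
  have h₂ : IsCoupling π₂ ν ρ := h₂
  have := h₁.isFiniteMeasure
  have := h₂.isFiniteMeasure
  set κ := π₂.condKernel
  have hπ₂ : ν ⊗ₘ κ = π₂ := by
    have := π₂.disintegrate π₂.condKernel
    rwa [Measure.fst, h₂.fst] at this
  set κ' : Kernel (X × X) X := κ.comap Prod.snd measurable_snd
  set Θ := π₁ ⊗ₘ κ'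
  have hΘ₂ : ∀ g : X × X → ℝ≥0∞, Measurable g →
      ∫⁻ w, g (w.1.2, w.2) ∂Θ = ∫⁻ z, g z ∂π₂ := by
    intro g hg
    rw [Measure.lintegral_compProd (by fun_prop), ← hπ₂, Measure.lintegral_compProd hg,
      ← h₁.lintegral_snd (hg.lintegral_kernel_prod_right')]
    rfl
  have hΘ₁ : ∀ g : X × X → ℝ≥0∞, Measurable g → ∫⁻ w, g w.1 ∂Θ = ∫⁻ z, g z ∂π₁ := by
    intro g hg
    rw [Measure.lintegral_compProd (by fun_prop)]
    simp
  have hc : IsCoupling (Θ.map fun w => (w.1.1, w.2)) μ ρ := by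
    constructor
    · refine Measure.ext_of_lintegral _ fun g hg => ?_
      rw [Measure.map_map measurable_fst (by fun_prop), lintegral_map hg (by fun_prop),
        ← h₁.lintegral_fst hg, ← hΘ₁ (fun z => g z.1) (by fun_prop)]
      rfl
    · refine Measure.ext_of_lintegral _ fun g hg => ?_
      rw [Measure.map_map measurable_snd (by fun_prop), lintegral_map hg (by fun_prop),
        ← h₂.lintegral_snd hg, ← hΘ₂ (fun z => g z.2) (by fun_prop)]
      rfl
  refine (W2sq_le hc).trans ?_
  rw [sqCost, lintegral_map measurable_edist_sq (by fun_prop), sqCost, sqCost,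
    ← hΘ₁ _ measurable_edist_sq, ← hΘ₂ _ measurable_edist_sq,
    ← lintegral_const_mul' _ _ h32, ← lintegral_const_mul' _ _ (by norm_num),
    ← lintegral_add_left]
  · exact lintegral_mono fun w => edist_sq_le _ _ _
  · exact (measurable_edist_sq.comp measurable_fst).const_mul _

end SquaredDistance

theorem Wp_two_eq {E : Type*} [EMetricSpace E] [MeasurableSpace E] (μ ν : Measure E) :
    Wp 2 μ ν = W2sq μ ν ^ (1 / 2 : ℝ) := by
  have h : ∀ a : ℝ≥0∞, a ^ (1 / 2 : ℝ) = ENNReal.orderIsoRpow (1 / 2) (by norm_num) a := fun _ => rfl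
  rw [Wp, W2sq, h]
  simp_rw [OrderIso.map_iInf, ← h]
  refine le_antisymm ?_ ?_
  · refine le_iInf₂ fun π hπ => (iInf₂_le π ⟨hπ.fst, hπ.snd⟩).trans_eq ?_
    simp [sqCost]
  · refine le_iInf₂ fun π hπ => (iInf₂_le π ⟨hπ.1, hπ.2⟩).trans_eq ?_
    simp [sqCost]

theorem Wp_two_le_of_forall_coupling {E : Type*} [EMetricSpace E] [MeasurableSpace E]
    {μ ν μ' ν' : Measure E} {K : ℝ} (hK : 0 < K)
    (h : ∀ π, IsCoupling π μ' ν' → W2sq μ ν ≤ ENNReal.ofReal K * sqCost π) :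
    Wp 2 μ ν ≤ ENNReal.ofReal (√K) * Wp 2 μ' ν' := by
  have h0 : ENNReal.ofReal K ≠ 0 := by simpa using hK
  have hle : W2sq μ ν ≤ ENNReal.ofReal K * W2sq μ' ν' := by
    conv_rhs => unfold W2sq
    simp_rw [ENNReal.mul_iInf_of_ne h0 ENNReal.ofReal_ne_top]
    exact le_iInf₂ h
  rw [Wp_two_eq, Wp_two_eq, Real.sqrt_eq_rpow, ← ENNReal.ofReal_rpow_of_pos hK,
    ← ENNReal.mul_rpow_of_nonneg _ _ (by norm_num)]
  gcongr

section Interval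

/-- Lebesgue measure on the unit interval. -/
def unitMeasure : Measure ℝ := volume.restrict (Icc (0 : ℝ) 1)

instance : IsProbabilityMeasure unitMeasure :=
  ⟨by simp [unitMeasure]⟩

theorem unitMeasure_compl : unitMeasure (Icc (0 : ℝ) 1)ᶜ = 0 := by
  simp [unitMeasure, Measure.restrict_apply measurableSet_Icc.compl]

/-- The normalized distribution function of a measure on the line. -/
def normalizedCdf (α : Measure ℝ) (t : ℝ) : ℝ := (α (Iic t)).toReal / (α univ).toReal

theorem unitMeasure_Ioc {s t : ℝ} (hs : 0 ≤ s) (ht : t ≤ 1) :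
    unitMeasure (Ioc s t) = ENNReal.ofReal (t - s) := by
  rw [unitMeasure, Measure.restrict_apply measurableSet_Ioc, inter_eq_left.2, Real.volume_Ioc]
  exact fun x hx => ⟨hs.trans hx.1.le, hx.2.trans ht⟩

/-- A finite measure on the unit interval whose density is bounded and at least `1`. -/
structure IsAdmissible (α : Measure ℝ) (M : ℝ) : Prop where
  finite : IsFiniteMeasure α
  compl : α (Icc (0 : ℝ) 1)ᶜ = 0
  zero : α {0} = 0
  lower : ∀ s t, 0 ≤ s → s ≤ t → t ≤ 1 → t - s ≤ (α (Ioc s t)).toReal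
  upper : ∀ s t, 0 ≤ s → s ≤ t → t ≤ 1 → (α (Ioc s t)).toReal ≤ M * (t - s)

theorem isAdmissible_withDensity {g : ℝ → ℝ≥0} (M : ℝ≥0) (hM : ∀ s, g s ≤ M) :
    IsAdmissible (unitMeasure.withDensity fun s => (1 + g s : ℝ≥0∞)) (1 + M) := by
  have hac := withDensity_absolutelyContinuous unitMeasure fun s => (1 + g s : ℝ≥0∞)
  have hfin : IsFiniteMeasure (unitMeasure.withDensity fun s => (1 + g s : ℝ≥0∞)) := by
    refine isFiniteMeasure_withDensity (ne_of_lt ?_)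
    calc ∫⁻ s, (1 + g s : ℝ≥0∞) ∂unitMeasure ≤ ∫⁻ _, (1 + M : ℝ≥0∞) ∂unitMeasure := by
          gcongr with s; exact hM s
      _ < ∞ := by simp
  refine ⟨hfin, hac unitMeasure_compl, hac (by simp [unitMeasure]), fun s t hs hst ht => ?_,
    fun s t hs hst ht => ?_⟩
  · rw [← ENNReal.ofReal_le_iff_le_toReal (measure_ne_top _ _), withDensity_apply _ measurableSet_Ioc,
      ← unitMeasure_Ioc hs ht, ← setLIntegral_one]
    gcongr
    exact le_self_add
  · refine ENNReal.toReal_le_of_le_ofReal (mul_nonneg (by positivity) (sub_nonneg.2 hst)) ?_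
    rw [withDensity_apply _ measurableSet_Ioc, ENNReal.ofReal_mul (by positivity),
      ← unitMeasure_Ioc hs ht, ← setLIntegral_const]
    refine lintegral_mono fun x => ?_
    rw [ENNReal.ofReal_add zero_le_one M.coe_nonneg, ENNReal.ofReal_one, ENNReal.ofReal_coe_nnreal]
    gcongr
    exact hM x

namespace IsAdmissible

variable {α : Measure ℝ} {M : ℝ}

theorem cdf_sub (h : IsAdmissible α M) {s t : ℝ} (hst : s ≤ t) :
    (α (Iic t)).toReal = (α (Iic s)).toReal + (α (Ioc s t)).toReal := by
  have := h.finite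
  rw [← Iic_union_Ioc_eq_Iic hst, measure_union _ measurableSet_Ioc,
    ENNReal.toReal_add (measure_ne_top _ _) (measure_ne_top _ _)]
  exact Set.disjoint_left.2 fun x hx hx' => not_lt.2 hx hx'.1

theorem cdf_of_nonpos (h : IsAdmissible α M) {t : ℝ} (ht : t ≤ 0) : α (Iic t) = 0 := by
  refine measure_mono_null (t := (Icc (0 : ℝ) 1)ᶜ ∪ {0}) (fun x hx => ?_)
    (measure_union_null h.compl h.zero)
  rcases eq_or_lt_of_le (le_trans hx ht) with h0 | h0
  · exact Or.inr h0
  · exact Or.inl fun h' => not_lt.2 h'.1 h0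

theorem cdf_of_one_le (h : IsAdmissible α M) {t : ℝ} (ht : 1 ≤ t) : α (Iic t) = α univ := by
  refine measure_congr ?_
  rw [Filter.eventuallyEq_univ, mem_ae_iff]
  exact measure_mono_null (t := (Icc (0 : ℝ) 1)ᶜ) (fun x hx hx' => hx (hx'.2.trans ht)) h.compl

theorem one_le (h : IsAdmissible α M) : 1 ≤ (α univ).toReal := by
  have h1 := h.cdf_sub zero_le_one
  rw [h.cdf_of_nonpos le_rfl, h.cdf_of_one_le le_rfl] at h1
  have := h.lower 0 1 le_rfl zero_le_one le_rfl
  simp only [ENNReal.toReal_zero] at h1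
  linarith

theorem cdf_mono (h : IsAdmissible α M) {s t : ℝ} (hst : s ≤ t) :
    normalizedCdf α s ≤ normalizedCdf α t := by
  have := h.finite
  exact div_le_div_of_nonneg_right
    (ENNReal.toReal_mono (measure_ne_top _ _) (measure_mono (Iic_subset_Iic.2 hst)))
    ENNReal.toReal_nonneg

theorem continuousOn_cdf (h : IsAdmissible α M) :
    ContinuousOn (normalizedCdf α) (Icc 0 1) := by
  have hL : ContinuousOn (fun t => (α (Iic t)).toReal) (Icc 0 1) := by
    have : LipschitzOnWith M.toNNReal (fun t => (α (Iic t)).toReal) (Icc 0 1) := by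
      refine LipschitzOnWith.of_le_add_mul _ fun t ht s hs => ?_
      have hM : 0 ≤ M := by
        have h1 := h.lower 0 1 le_rfl zero_le_one le_rfl
        have h2 := h.upper 0 1 le_rfl zero_le_one le_rfl
        linarith
      rw [Real.coe_toNNReal _ hM]
      rcases le_total s t with hst | hst
      · rw [h.cdf_sub hst, Real.dist_eq, abs_of_nonneg (sub_nonneg.2 hst)]
        linarith [h.upper s t hs.1 hst ht.2]
      · rw [h.cdf_sub hst]
        have : 0 ≤ M * dist t s := by positivity
        linarith [(ENNReal.toReal_nonneg : 0 ≤ (α (Ioc t s)).toReal)]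
    exact this.continuousOn
  exact hL.div_const _

theorem map_normalizedCdf (h : IsAdmissible α M) (hm : Measurable (normalizedCdf α)) :
    α.map (normalizedCdf α) = α univ • unitMeasure := by
  have := h.finite
  have hpos : 0 < (α univ).toReal := zero_lt_one.trans_le h.one_le
  have : IsFiniteMeasure (α univ • unitMeasure) :=
    Measure.smul_finite _ (measure_ne_top _ _)
  have h1 : ∀ t, 1 ≤ t → normalizedCdf α t = 1 := fun t ht => by
    rw [normalizedCdf, h.cdf_of_one_le ht, div_self hpos.ne']
  have h0 : normalizedCdf α 0 = 0 := by
    rw [normalizedCdf, h.cdf_of_nonpos le_rfl]; simp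
  refine Measure.ext_of_Iic _ _ fun a => ?_
  rw [Measure.map_apply hm measurableSet_Iic, Measure.smul_apply, smul_eq_mul]
  rcases lt_or_ge a 0 with ha | ha
  · have e1 : normalizedCdf α ⁻¹' Iic a = ∅ := by
      refine eq_empty_of_forall_notMem fun t ht => ?_
      exact not_lt.2 (div_nonneg ENNReal.toReal_nonneg ENNReal.toReal_nonneg)
        (lt_of_le_of_lt ht ha)
    have e2 : unitMeasure (Iic a) = 0 :=
      measure_mono_null (t := (Icc (0 : ℝ) 1)ᶜ)
        (fun x hx hx' => not_lt.2 hx'.1 (lt_of_le_of_lt hx ha)) unitMeasure_compl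
    rw [e1, e2]; simp
  rcases le_or_gt 1 a with ha1 | ha1
  · have e1 : normalizedCdf α ⁻¹' Iic a = univ := by
      refine eq_univ_of_forall fun t => ?_
      have := h.cdf_mono (le_max_left t 1)
      rw [h1 _ (le_max_right _ _)] at this
      exact this.trans ha1
    have e2 : unitMeasure (Iic a) = 1 := by
      rw [prob_compl_eq_zero_iff measurableSet_Iic |>.symm]
      exact measure_mono_null (t := (Icc (0 : ℝ) 1)ᶜ) (fun x hx hx' => hx (hx'.2.trans ha1))
        unitMeasure_compl
    rw [e1, e2, mul_one]
  obtain ⟨t, ht, hta⟩ : ∃ t ∈ Icc (0 : ℝ) 1, normalizedCdf α t = a := by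
    have := intermediate_value_Icc zero_le_one h.continuousOn_cdf
    rw [h0, h1 1 le_rfl] at this
    exact this ⟨ha, ha1.le⟩
  have e1 : normalizedCdf α ⁻¹' Iic a = Iic t := by
    ext s
    refine ⟨fun hs => ?_, fun hs => (h.cdf_mono hs).trans_eq hta⟩
    by_contra hst
    have hst : t < s := not_le.1 hst
    have hs : normalizedCdf α s ≤ a := hs
    rcases le_or_gt 1 s with h1s | h1s
    · rw [h1 s h1s] at hs
      exact not_lt.2 hs ha1
    · rw [← hta, normalizedCdf, normalizedCdf, div_le_div_iff_of_pos_right hpos,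
        h.cdf_sub hst.le] at hs
      linarith [h.lower t s ht.1 hst.le h1s.le]
  have e2 : unitMeasure (Iic a) = ENNReal.ofReal a := by
    have : Iic a = Iic 0 ∪ Ioc 0 a := (Iic_union_Ioc_eq_Iic ha).symm
    have hz : unitMeasure (Iic 0) = 0 := by
      refine measure_mono_null (t := (Icc (0 : ℝ) 1)ᶜ ∪ {0}) (fun x hx => ?_)
        (measure_union_null unitMeasure_compl (by simp [unitMeasure]))
      rcases eq_or_lt_of_le (mem_Iic.1 hx) with h0 | h0
      · exact Or.inr h0
      · exact Or.inl fun h' => not_lt.2 h'.1 h0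
    rw [this, measure_union _ measurableSet_Ioc, hz, unitMeasure_Ioc le_rfl ha1.le]
    · simp
    · exact Set.disjoint_left.2 fun x hx hx' => not_lt.2 hx hx'.1
  rw [e1, e2, ← hta, normalizedCdf, ENNReal.ofReal_div_of_pos hpos,
    ENNReal.ofReal_toReal (measure_ne_top _ _), ENNReal.ofReal_toReal (measure_ne_top _ _),
    ENNReal.mul_div_cancel]
  · exact fun hz => hpos.ne' (by simp [hz])
  · exact measure_ne_top _ _

theorem abs_sub_normalizedCdf_le (h : IsAdmissible α M) {t : ℝ} (ht : t ∈ Icc (0 : ℝ) 1) :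
    |t - normalizedCdf α t| ≤ ((α univ).toReal - 1) / (α univ).toReal := by
  have hpos : 0 < (α univ).toReal := zero_lt_one.trans_le h.one_le
  have e1 := h.cdf_sub ht.1
  have e2 := h.cdf_sub ht.2
  rw [h.cdf_of_nonpos le_rfl] at e1
  rw [h.cdf_of_one_le le_rfl] at e2
  have l1 := h.lower 0 t le_rfl ht.1 ht.2
  have l2 := h.lower t 1 ht.1 ht.2 le_rfl
  have hT := h.one_le
  simp only [ENNReal.toReal_zero] at e1
  have key : t - normalizedCdf α t = (t * (α univ).toReal - (α (Iic t)).toReal) / (α univ).toReal := by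
    rw [normalizedCdf]; field_simp
  rw [key, abs_div, abs_of_pos hpos]
  gcongr
  rw [abs_le]
  constructor
  · nlinarith [ht.1, ht.2]
  · nlinarith [ht.1, ht.2]

end IsAdmissible

end Interval

theorem sq_lintegral_le {X : Type*} [MeasurableSpace X] (μ : Measure X) {f : X → ℝ≥0∞}
    (hf : AEMeasurable f μ) : (∫⁻ x, f x ∂μ) ^ 2 ≤ μ univ * ∫⁻ x, f x ^ 2 ∂μ := by
  have h := ENNReal.lintegral_mul_le_Lp_mul_Lq μ Real.HolderConjugate.two_two hf
    (aemeasurable_const (b := (1 : ℝ≥0∞)))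
  simp only [Pi.mul_apply, mul_one, ENNReal.one_rpow, lintegral_one] at h
  have h2 := pow_le_pow_left₀ zero_le h 2
  refine h2.trans_eq ?_
  rw [mul_pow, ← ENNReal.rpow_natCast, ← ENNReal.rpow_natCast, ← ENNReal.rpow_mul,
    ← ENNReal.rpow_mul]
  norm_num
  rw [mul_comm]

section ChiSquare

variable {X : Type*} [MeasurableSpace X] [PseudoEMetricSpace X]

/-- Increasing the density of `ν` by a bounded function `u` costs at most `K ∫ u²`, in the
sense of quadratic transport to a multiple of `ν`. -/
def ChiSqTransport (ν : Measure X) (K : ℝ≥0∞) : Prop :=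
  ∀ u : X → ℝ≥0, Measurable u → (∃ M, ∀ x, u x ≤ M) →
    ∃ π, IsCoupling π (ν.withDensity fun x => 1 + u x) ((1 + ∫⁻ x, u x ∂ν) • ν) ∧
      sqCost π ≤ K * ∫⁻ x, (u x : ℝ≥0∞) ^ 2 ∂ν

theorem ChiSqTransport.map {Y : Type*} [MeasurableSpace Y] [PseudoEMetricSpace Y]
    [OpensMeasurableSpace Y] [SecondCountableTopology Y] {ν : Measure X} [IsFiniteMeasure ν]
    {K : ℝ≥0∞} (h : ChiSqTransport ν K)
    {T : X → Y} (hT : Measurable T) {A : ℝ≥0} {s : Set X} (hs : MeasurableSet s)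
    (hTs : LipschitzOnWith A T s) (hν : ν sᶜ = 0) :
    ChiSqTransport (ν.map T) ((A : ℝ≥0∞) ^ 2 * K) := by
  rintro u hu ⟨M, hM⟩
  obtain ⟨π, hπ, hc⟩ := h (u ∘ T) (hu.comp hT) ⟨M, fun x => hM _⟩
  have e1 : ∫⁻ x, u x ∂ν.map T = ∫⁻ x, (u ∘ T) x ∂ν := lintegral_map (by fun_prop) hT
  have e2 : ∫⁻ x, (u x : ℝ≥0∞) ^ 2 ∂ν.map T = ∫⁻ x, ((u ∘ T) x : ℝ≥0∞) ^ 2 ∂ν :=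
    lintegral_map (by fun_prop) hT
  have hm : Measurable (Prod.map T T) := hT.prodMap hT
  refine ⟨π.map (Prod.map T T), ⟨?_, ?_⟩, ?_⟩
  · rw [Measure.map_map measurable_fst hm, show Prod.fst ∘ Prod.map T T = T ∘ Prod.fst from rfl,
      ← Measure.map_map hT measurable_fst, hπ.fst]
    refine Measure.ext_of_lintegral _ fun g hg => ?_
    rw [lintegral_map hg hT, lintegral_withDensity_eq_lintegral_mul _ (by fun_prop) (by fun_prop),
      lintegral_withDensity_eq_lintegral_mul _ (by fun_prop) hg, lintegral_map (by fun_prop) hT]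
    rfl
  · rw [Measure.map_map measurable_snd hm,
      show Prod.snd ∘ Prod.map T T = T ∘ Prod.snd from rfl,
      ← Measure.map_map hT measurable_snd, hπ.snd, Measure.map_smul, e1]
  · have hae := hπ.ae_mem hs (withDensity_absolutelyContinuous _ _ hν) (by simp [hν])
    rw [sqCost, lintegral_map measurable_edist_sq hm, e2, mul_assoc]
    refine le_trans ?_ (mul_le_mul_right hc _)
    rw [sqCost, ← lintegral_const_mul' _ _ (by simp)]
    refine lintegral_mono_ae ?_
    filter_upwards [hae] with z hz
    rw [← mul_pow]
    gcongr
    exact hTs hz.1 hz.2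

theorem ChiSqTransport.prod_unitMeasure [OpensMeasurableSpace X] [SecondCountableTopology X]
    {ν : Measure X} [IsProbabilityMeasure ν] {K : ℝ≥0∞} (h : ChiSqTransport ν K) :
    ChiSqTransport (ν.prod unitMeasure) (K + 1) := by
  rintro u hu ⟨M, hM⟩
  have hule : ∀ x, ∫⁻ t, u (x, t) ∂unitMeasure ≤ M := fun x =>
    (lintegral_mono fun t => ENNReal.coe_le_coe.2 (hM (x, t))).trans_eq (by simp)
  set u₀ : X → ℝ≥0 := fun x => (∫⁻ t, u (x, t) ∂unitMeasure).toNNReal with hu₀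
  have hcoe : ∀ x, (u₀ x : ℝ≥0∞) = ∫⁻ t, u (x, t) ∂unitMeasure := fun x =>
    ENNReal.coe_toNNReal (ne_top_of_le_ne_top coe_ne_top (hule x))
  have hu₀m : Measurable u₀ := by
    refine ENNReal.measurable_toNNReal.comp (Measurable.lintegral_prod_right' (f := fun z : X × ℝ => (u z : ℝ≥0∞)) ?_)
    fun_prop
  obtain ⟨π, hπ, hc⟩ := h u₀ hu₀m
    ⟨M, fun x => by rw [← ENNReal.coe_le_coe, hcoe]; exact hule x⟩
  set α : X → Measure ℝ := fun x => unitMeasure.withDensity fun t => (1 + u (x, t) : ℝ≥0∞)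
    with hα
  have hadm : ∀ x, IsAdmissible (α x) (1 + M) := fun x =>
    isAdmissible_withDensity M fun t => hM (x, t)
  have huniv : ∀ x, α x univ = 1 + u₀ x := fun x => by
    rw [hα, withDensity_apply _ .univ, hcoe, Measure.restrict_univ,
      lintegral_add_left measurable_const]
    simp
  set S : X × ℝ → ℝ := fun z => normalizedCdf (α z.1) z.2 with hS
  have hSm : Measurable S := by
    have : S = fun z : X × ℝ => (∫⁻ s, (if s ≤ z.2 then (1 + u (z.1, s) : ℝ≥0∞) else 0)
        ∂unitMeasure).toReal / (1 + u₀ z.1 : ℝ≥0∞).toReal := by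
      funext z
      rw [hS]
      simp only [normalizedCdf, huniv]
      rw [hα, withDensity_apply _ measurableSet_Iic, ← lintegral_indicator measurableSet_Iic]
      rfl
    rw [this]
    refine Measurable.div (ENNReal.measurable_toReal.comp ?_) (by fun_prop)
    refine Measurable.lintegral_prod_right' (f := fun w : (X × ℝ) × ℝ =>
      if w.2 ≤ w.1.2 then (1 + u (w.1.1, w.2) : ℝ≥0∞) else 0) ?_
    exact Measurable.ite (measurableSet_le (by fun_prop) (by fun_prop)) (by fun_prop) (by fun_prop)
  have hpos : ∀ x, (1 + u₀ x : ℝ≥0∞) ≠ 0 := fun x => by simp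
  have htop : ∀ x, (1 + u₀ x : ℝ≥0∞) ≠ ∞ := fun x => by simp
  set ρ : (X × X) × ℝ → ℝ≥0∞ := fun w => (1 + u (w.1.1, w.2)) / (1 + u₀ w.1.1) with hρ
  have hρm : Measurable ρ := by fun_prop
  set Φ : (X × X) × ℝ → (X × ℝ) × (X × ℝ) := fun w => ((w.1.1, w.2), (w.1.2, S (w.1.1, w.2)))
    with hΦ
  have hΦm : Measurable Φ := by fun_prop
  have : IsFiniteMeasure (ν.withDensity fun x => (1 + u₀ x : ℝ≥0∞)) := by
    refine isFiniteMeasure_withDensity (ne_of_lt ?_)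
    rw [lintegral_add_left measurable_const]
    refine ENNReal.add_lt_top.2 ⟨by simp, lt_of_le_of_lt
      (lintegral_mono fun x => (hcoe x).trans_le (hule x)) (by simp)⟩
  have hfin := hπ.isFiniteMeasure
  have hα_int : ∀ x (g : ℝ → ℝ≥0∞), Measurable g →
      ∫⁻ t, (1 + u (x, t)) / (1 + u₀ x) * g t ∂unitMeasure = (1 + u₀ x : ℝ≥0∞)⁻¹ * ∫⁻ t, g t ∂α x := by
    intro x g hg
    rw [hα, lintegral_withDensity_eq_lintegral_mul _ (by fun_prop) hg, ← lintegral_const_mul]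
    · refine lintegral_congr fun t => ?_
      simp only [Pi.mul_apply]
      rw [div_eq_mul_inv]; ring
    · fun_prop
  have hint : ∀ g : (X × ℝ) × (X × ℝ) → ℝ≥0∞, Measurable g →
      ∫⁻ w, g w ∂(((π.prod unitMeasure).withDensity ρ).map Φ) =
        ∫⁻ z, (1 + u₀ z.1 : ℝ≥0∞)⁻¹ * ∫⁻ t, g ((z.1, t), (z.2, S (z.1, t))) ∂α z.1 ∂π := by
    intro g hg
    rw [lintegral_map hg hΦm, lintegral_withDensity_eq_lintegral_mul _ hρm (by fun_prop),
      lintegral_prod _ (by fun_prop)]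
    refine lintegral_congr fun z => ?_
    rw [← hα_int _ _ (by fun_prop)]
    rfl
  have hmass : ∫⁻ z, (u z : ℝ≥0∞) ∂(ν.prod unitMeasure) = ∫⁻ x, u₀ x ∂ν := by
    rw [lintegral_prod _ (by fun_prop)]
    exact lintegral_congr fun x => (hcoe x).symm
  have hαm : ∀ g : X × ℝ → ℝ≥0∞, Measurable g → Measurable fun x => ∫⁻ t, g (x, t) ∂α x := by
    intro g hg
    have : (fun x => ∫⁻ t, g (x, t) ∂α x) =
        fun x => ∫⁻ t, (1 + u (x, t)) * g (x, t) ∂unitMeasure := by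
      funext x
      rw [hα, lintegral_withDensity_eq_lintegral_mul _ (by fun_prop) (by fun_prop)]
      rfl
    rw [this]
    exact Measurable.lintegral_prod_right' (f := fun z : X × ℝ => (1 + u z) * g z) (by fun_prop)
  have hfst : ∀ g : X → ℝ≥0∞, Measurable g →
      ∫⁻ z, (1 + u₀ z.1 : ℝ≥0∞)⁻¹ * g z.1 ∂π = ∫⁻ x, g x ∂ν := by
    intro g hg
    rw [hπ.lintegral_fst (g := fun x => (1 + u₀ x : ℝ≥0∞)⁻¹ * g x) (by fun_prop),
      lintegral_withDensity_eq_lintegral_mul _ (by fun_prop) (by fun_prop)]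
    refine lintegral_congr fun x => ?_
    rw [Pi.mul_apply, ← mul_assoc, ENNReal.mul_inv_cancel (hpos x) (htop x), one_mul]
  refine ⟨((π.prod unitMeasure).withDensity ρ).map Φ, ⟨?_, ?_⟩, ?_⟩
  · refine Measure.ext_of_lintegral _ fun g hg => ?_
    rw [lintegral_map hg measurable_fst, hint _ (by fun_prop),
      hfst (fun x => ∫⁻ t, g (x, t) ∂α x) (hαm g hg),
      lintegral_withDensity_eq_lintegral_mul _ (by fun_prop) hg, lintegral_prod _ (by fun_prop)]
    refine lintegral_congr fun x => ?_
    rw [hα, lintegral_withDensity_eq_lintegral_mul _ (by fun_prop) (by fun_prop)]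
    rfl
  · refine Measure.ext_of_lintegral _ fun g hg => ?_
    rw [lintegral_map hg measurable_snd, hint _ (by fun_prop), hmass, lintegral_smul_measure,
      smul_eq_mul, lintegral_prod _ (by fun_prop)]
    have hgm : Measurable fun x => ∫⁻ t, g (x, t) ∂unitMeasure :=
      Measurable.lintegral_prod_right' hg
    have := hπ.lintegral_snd hgm
    rw [lintegral_smul_measure, smul_eq_mul] at this
    rw [← this]
    refine lintegral_congr fun z => ?_
    have hSz : Measurable (normalizedCdf (α z.1)) := by
      change Measurable fun t => S (z.1, t)
      fun_prop
    have e := (hadm z.1).map_normalizedCdf hSz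
    rw [show (∫⁻ t, g (z.2, S (z.1, t)) ∂α z.1) =
      ∫⁻ s, g (z.2, s) ∂((α z.1).map (normalizedCdf (α z.1))) from
        (lintegral_map (f := fun s => g (z.2, s)) (by fun_prop) hSz).symm, e, lintegral_smul_measure, smul_eq_mul, huniv,
        ← mul_assoc, ENNReal.inv_mul_cancel (hpos _) (htop _), one_mul]
  · have hcost : ∀ z : X × X, ∫⁻ t, edist (z.1, t) (z.2, S (z.1, t)) ^ 2 ∂α z.1 ≤
        (1 + u₀ z.1) * (edist z.1 z.2 ^ 2 + (u₀ z.1 / (1 + u₀ z.1)) ^ 2) := by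
      intro z
      rw [← huniv z.1, mul_comm, ← lintegral_const]
      refine lintegral_mono_ae ?_
      filter_upwards [measure_eq_zero_iff_ae_notMem.1 (hadm z.1).compl] with t ht
      have ht := not_not.1 ht
      have h1 : edist t (S (z.1, t)) ≤ u₀ z.1 / (1 + u₀ z.1) := by
        have := (hadm z.1).abs_sub_normalizedCdf_le ht
        rw [edist_dist, Real.dist_eq]
        refine (ENNReal.ofReal_le_ofReal this).trans_eq ?_
        have : (1 + u₀ z.1 : ℝ≥0∞).toReal = 1 + u₀ z.1 := by
          rw [ENNReal.toReal_add (by simp) (by simp)]; simp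
        rw [huniv, this, ENNReal.ofReal_div_of_pos (by positivity), ENNReal.ofReal_add zero_le_one (by positivity)]
        simp
      rw [huniv, Prod.edist_eq]
      refine le_trans ?_ (add_le_add le_rfl (pow_le_pow_left₀ zero_le h1 2))
      rcases max_cases (edist z.1 z.2) (edist t (S (z.1, t))) with hh | hh <;> simp only [hh.1]
      · exact le_self_add
      · exact le_add_self
    rw [sqCost, hint _ measurable_edist_sq]
    have hJ : ∫⁻ x, (u₀ x : ℝ≥0∞) ^ 2 ∂ν ≤ ∫⁻ z, (u z : ℝ≥0∞) ^ 2 ∂(ν.prod unitMeasure) := by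
      rw [lintegral_prod _ (by fun_prop)]
      refine lintegral_mono fun x => ?_
      have := sq_lintegral_le unitMeasure (f := fun t => (u (x, t) : ℝ≥0∞)) (by fun_prop)
      rwa [measure_univ, one_mul, ← hcoe] at this
    calc _ ≤ ∫⁻ z : X × X, (edist z.1 z.2 ^ 2 + (1 + u₀ z.1 : ℝ≥0∞)⁻¹ * (u₀ z.1 : ℝ≥0∞) ^ 2) ∂π := by
          refine lintegral_mono fun z => ?_
          refine (mul_le_mul_right (hcost z) _).trans ?_
          rw [← mul_assoc, ENNReal.inv_mul_cancel (hpos _) (htop _), one_mul]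
          refine add_le_add le_rfl ?_
          rw [div_eq_mul_inv, mul_pow, mul_comm, pow_two (_⁻¹), mul_assoc]
          refine mul_le_mul_right ?_ _
          refine mul_le_of_le_one_left zero_le ?_
          exact ENNReal.inv_le_one.2 le_self_add
      _ = sqCost π + ∫⁻ x, (u₀ x : ℝ≥0∞) ^ 2 ∂ν := by
          rw [lintegral_add_left measurable_edist_sq, hfst (fun x => (u₀ x : ℝ≥0∞) ^ 2) (by fun_prop)]
          rfl
      _ ≤ (K + 1) * ∫⁻ x, (u₀ x : ℝ≥0∞) ^ 2 ∂ν := by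
          rw [add_mul, one_mul]
          exact add_le_add hc le_rfl
      _ ≤ _ := by gcongr

end ChiSquare

section Cube

/-- Lebesgue measure on the unit cube. -/
def unitCube (n : ℕ) : Measure (Fin n → ℝ) := Measure.pi fun _ => unitMeasure

instance (n : ℕ) : IsProbabilityMeasure (unitCube n) := by
  unfold unitCube; infer_instance

theorem unitCube_succ (n : ℕ) :
    unitCube (n + 1) = ((unitCube n).prod unitMeasure).map
      fun z => (Fin.cons z.2 z.1 : Fin (n + 1) → ℝ) := by
  have h := (measurePreserving_piFinSuccAbove (fun _ : Fin (n + 1) => unitMeasure) 0).symm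
  have h' := h.comp (Measure.measurePreserving_swap (μ := unitCube n) (ν := unitMeasure))
  rw [unitCube, ← h'.map_eq]
  congr 1
  funext z
  exact Fin.insertNth_zero' ..

theorem chiSqTransport_unitCube (n : ℕ) : ChiSqTransport (unitCube n) n := by
  induction n with
  | zero =>
    intro u hu _
    refine ⟨_, ⟨(IsCoupling.diag _).fst, ?_⟩, ?_⟩
    · rw [(IsCoupling.diag _).snd]
      have : ∀ x, (u x : ℝ≥0∞) = u default := fun x => by rw [Subsingleton.elim x default]
      simp_rw [this]
      rw [withDensity_const, lintegral_const, measure_univ, mul_one]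
    · rw [sqCost, lintegral_map measurable_edist_sq (by fun_prop)]
      simp
  | succ n ih =>
    have h := ih.prod_unitMeasure.map (T := fun z => (Fin.cons z.2 z.1 : Fin (n + 1) → ℝ))
      (A := 1) (s := univ) ?_ .univ ?_ (by simp)
    · rw [← unitCube_succ] at h
      simpa using h
    · refine measurable_pi_lambda _ fun i => ?_
      refine Fin.cases ?_ (fun j => ?_) i
      · simpa using measurable_snd
      · simp only [Fin.cons_succ]; fun_prop
    · refine LipschitzWith.lipschitzOnWith fun z w => ?_
      rw [ENNReal.coe_one, one_mul, edist_pi_le_iff]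
      intro i
      refine Fin.cases ?_ (fun j => ?_) i
      · simp only [Fin.cons_zero]; exact le_max_right _ _
      · simp only [Fin.cons_succ]
        exact (edist_le_pi_edist _ _ j).trans (le_max_left _ _)

theorem unitCube_eq_restrict (n : ℕ) :
    unitCube n = (μH[n] : Measure (Fin n → ℝ)).restrict (Set.pi univ fun _ => Icc 0 1) := by
  have := hausdorffMeasure_pi_real (ι := Fin n)
  rw [Fintype.card_fin] at this
  rw [this, volume_pi, Measure.restrict_pi_pi]
  rfl

end Cube

section RadialMap

variable {V W : Type*} [NormedAddCommGroup V] [NormedSpace ℝ V] [NormedAddCommGroup W]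
  [NormedSpace ℝ W]

/-- The norm-preserving positively homogeneous modification of a linear isomorphism. -/
def radialMap (e : V ≃L[ℝ] W) (v : V) : W := (‖v‖ / ‖e v‖) • e v

theorem norm_radialMap (e : V ≃L[ℝ] W) (v : V) : ‖radialMap e v‖ = ‖v‖ := by
  rcases eq_or_ne v 0 with rfl | hv
  · simp [radialMap]
  have : ‖e v‖ ≠ 0 := by simpa using hv
  rw [radialMap, norm_smul, norm_div, norm_norm, norm_norm, div_mul_cancel₀ _ this]

theorem radialMap_symm_radialMap (e : V ≃L[ℝ] W) (v : V) :
    radialMap e.symm (radialMap e v) = v := by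
  rcases eq_or_ne v 0 with rfl | hv
  · simp [radialMap]
  have h1 : ‖e v‖ ≠ 0 := by simpa using hv
  have h2 : ‖v‖ ≠ 0 := by simpa using hv
  rw [radialMap, norm_radialMap, radialMap, map_smul, e.symm_apply_apply, norm_smul, norm_div,
    norm_norm, norm_norm, smul_smul]
  field_simp
  simp

theorem norm_radialMap_sub_le (e : V ≃L[ℝ] W) (x y : V) :
    ‖radialMap e y - radialMap e x‖ ≤
      (2 * (‖(e : V →L[ℝ] W)‖ * ‖(e.symm : W →L[ℝ] V)‖) + 1) * ‖y - x‖ := by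
  set κ := ‖(e : V →L[ℝ] W)‖
  set κ' := ‖(e.symm : W →L[ℝ] V)‖
  have hκ : 0 ≤ κ := norm_nonneg _
  have hκ' : 0 ≤ κ' := norm_nonneg _
  have hone : ‖y - x‖ ≤ (2 * (κ * κ') + 1) * ‖y - x‖ :=
    le_mul_of_one_le_left (norm_nonneg _) (by nlinarith [mul_nonneg hκ hκ'])
  rcases eq_or_ne x 0 with rfl | hx
  · have : radialMap e (0 : V) = 0 := by simp [radialMap]
    rw [this, sub_zero, norm_radialMap]
    simpa using hone
  rcases eq_or_ne y 0 with rfl | hy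
  · have : radialMap e (0 : V) = 0 := by simp [radialMap]
    rw [this, zero_sub, norm_neg, norm_radialMap]
    simpa using hone
  have hx' : 0 < ‖e x‖ := by simpa using hx
  have hy' : 0 < ‖e y‖ := by simpa using hy
  have hle : ‖y‖ ≤ κ' * ‖e y‖ := by
    simpa using (e.symm : W →L[ℝ] V).le_opNorm (e y)
  have hd : ‖e y - e x‖ ≤ κ * ‖y - x‖ := by
    rw [← map_sub]; exact (e : V →L[ℝ] W).le_opNorm (y - x)
  have hq : |‖e x‖ - ‖e y‖| ≤ κ * ‖y - x‖ :=
    (abs_norm_sub_norm_le _ _).trans (by rwa [norm_sub_rev])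
  have hp : |‖y‖ - ‖x‖| ≤ ‖y - x‖ := abs_norm_sub_norm_le _ _
  have hratio : ‖y‖ / ‖e y‖ ≤ κ' := by rwa [div_le_iff₀ hy']
  have key : radialMap e y - radialMap e x =
      (‖y‖ / ‖e y‖) • (e y - e x) + (‖y‖ / ‖e y‖ - ‖x‖ / ‖e x‖) • e x := by
    rw [radialMap, radialMap, smul_sub, sub_smul]; abel
  have h2 : |‖y‖ / ‖e y‖ - ‖x‖ / ‖e x‖| * ‖e x‖ ≤ (κ * κ' + 1) * ‖y - x‖ := by
    have : |‖y‖ / ‖e y‖ - ‖x‖ / ‖e x‖| * ‖e x‖ =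
        |‖y‖ / ‖e y‖ * (‖e x‖ - ‖e y‖) + (‖y‖ - ‖x‖)| := by
      rw [← abs_of_pos hx', ← abs_mul, abs_of_pos hx']
      congr 1
      field_simp
      ring
    rw [this]
    refine (abs_add_le _ _).trans ?_
    rw [abs_mul, abs_of_nonneg (by positivity)]
    have := mul_le_mul hratio hq (abs_nonneg _) hκ'
    linarith
  rw [key]
  refine (norm_add_le _ _).trans ?_
  rw [norm_smul, norm_smul, Real.norm_of_nonneg (by positivity), Real.norm_eq_abs]
  have h1 := mul_le_mul hratio hd (norm_nonneg _) hκ'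
  linarith

theorem exists_lipschitzWith_radialMap (e : V ≃L[ℝ] W) :
    ∃ A : ℝ≥0, LipschitzWith A (radialMap e) :=
  ⟨_, LipschitzWith.of_dist_le_mul (K := (2 * (‖(e : V →L[ℝ] W)‖₊ * ‖(e.symm : W →L[ℝ] V)‖₊) + 1))
    fun x y => by
      rw [dist_eq_norm, dist_eq_norm]
      exact norm_radialMap_sub_le e y x⟩

end RadialMap

section Ball

theorem exists_chiSqTransport_unitBall (n : ℕ) :
    ∃ (M : Measure (EuclideanSpace ℝ (Fin n))) (K a b : ℝ≥0), IsProbabilityMeasure M ∧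
      M (closedBall 0 1)ᶜ = 0 ∧ ChiSqTransport M K ∧
      (∀ s, MeasurableSet s → μH[n] (s ∩ closedBall 0 1) ≤ a * M s) ∧
      (∀ s, MeasurableSet s → M s ≤ b * μH[n] (s ∩ closedBall 0 1)) := by
  set e : (Fin n → ℝ) ≃L[ℝ] EuclideanSpace ℝ (Fin n) := (EuclideanSpace.equiv (Fin n) ℝ).symm
  obtain ⟨A, hA⟩ := exists_lipschitzWith_radialMap e
  obtain ⟨A', hA'⟩ := exists_lipschitzWith_radialMap e.symm
  set G : (Fin n → ℝ) → EuclideanSpace ℝ (Fin n) :=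
    fun y => radialMap e ((2 : ℝ) • y - 1)
  set H : EuclideanSpace ℝ (Fin n) → (Fin n → ℝ) :=
    fun w => (2⁻¹ : ℝ) • (radialMap e.symm w + 1)
  have hG : LipschitzWith (A * 2) G := by
    refine hA.comp (LipschitzWith.of_dist_le_mul fun x y => ?_)
    rw [dist_sub_right, dist_smul₀]; simp
  have hH : LipschitzWith (2⁻¹ * A') H := by
    refine LipschitzWith.of_dist_le_mul fun x y => ?_
    rw [dist_smul₀, dist_add_right]
    have := hA'.dist_le_mul x y
    simp only [norm_inv, Real.norm_ofNat, NNReal.coe_mul, NNReal.coe_inv, NNReal.coe_ofNat]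
    linarith
  have hHG : ∀ y, H (G y) = y := fun y => by
    simp only [H, G, radialMap_symm_radialMap, sub_add_cancel, smul_smul]
    norm_num
  have hGH : ∀ w, G (H w) = w := fun w => by
    simp only [H, G, smul_smul]
    norm_num
    exact radialMap_symm_radialMap e.symm w
  set Q : Set (Fin n → ℝ) := Set.pi univ fun _ => Icc 0 1
  have hQ : ∀ y, y ∈ Q ↔ G y ∈ closedBall 0 1 := fun y => by
    rw [mem_closedBall_zero_iff, norm_radialMap, pi_norm_le_iff_of_nonneg zero_le_one]
    simp only [Q, mem_univ_pi, mem_Icc, Real.norm_eq_abs, abs_le, Pi.sub_apply, Pi.smul_apply,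
      Pi.one_apply, smul_eq_mul]
    refine forall_congr' fun i => ?_
    constructor <;> rintro ⟨h1, h2⟩ <;> constructor <;> linarith
  have hGm : Measurable G := hG.continuous.measurable
  have hMs : ∀ s, MeasurableSet s → (unitCube n).map G s = μH[n] (G ⁻¹' s ∩ Q) := fun s hs => by
    rw [Measure.map_apply hGm hs, unitCube_eq_restrict, Measure.restrict_apply (hGm hs)]
  refine ⟨(unitCube n).map G, (A * 2) ^ 2 * n, (A * 2) ^ n, (2⁻¹ * A') ^ n,
    Measure.isProbabilityMeasure_map hGm.aemeasurable, ?_, ?_, fun s hs => ?_, fun s hs => ?_⟩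
  · rw [hMs _ measurableSet_closedBall.compl]
    have : G ⁻¹' (closedBall 0 1)ᶜ ∩ Q = ∅ :=
      eq_empty_of_forall_notMem fun y hy => hy.1 ((hQ y).1 hy.2)
    rw [this, measure_empty]
  · have := (chiSqTransport_unitCube n).map hGm .univ hG.lipschitzOnWith (by simp)
    exact_mod_cast this
  · rw [hMs s hs]
    have hsub : s ∩ closedBall 0 1 ⊆ G '' (G ⁻¹' s ∩ Q) := fun w hw =>
      ⟨H w, ⟨by rw [mem_preimage, hGH]; exact hw.1, (hQ _).2 (by rw [hGH]; exact hw.2)⟩, hGH w⟩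
    refine (measure_mono hsub).trans ?_
    have := hG.hausdorffMeasure_image_le (d := n) (Nat.cast_nonneg n) (G ⁻¹' s ∩ Q)
    rw [ENNReal.rpow_natCast] at this
    exact_mod_cast this
  · rw [hMs s hs]
    have hsub : G ⁻¹' s ∩ Q ⊆ H '' (s ∩ closedBall 0 1) := fun y hy =>
      ⟨G y, ⟨hy.1, (hQ y).1 hy.2⟩, hHG y⟩
    refine (measure_mono hsub).trans ?_
    have := hH.hausdorffMeasure_image_le (d := n) (Nat.cast_nonneg n) (s ∩ closedBall 0 1)
    rw [ENNReal.rpow_natCast] at this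
    exact_mod_cast this

end Ball

section Weighted

theorem unitMeasure_Iic_le {t : ℝ} : unitMeasure (Iic t) ≤ ENNReal.ofReal t := by
  rw [unitMeasure, Measure.restrict_apply measurableSet_Iic]
  refine (measure_mono (t := Icc 0 t) fun x hx => ⟨hx.2.1, hx.1⟩).trans ?_
  simp

theorem ofReal_le_unitMeasure_Iic {t : ℝ} (ht : t ≤ 1) : ENNReal.ofReal t ≤ unitMeasure (Iic t) := by
  rcases le_total t 0 with h | h
  · simp [ENNReal.ofReal_of_nonpos h]
  rw [← sub_zero t, ← unitMeasure_Ioc le_rfl ht, sub_zero]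
  exact measure_mono fun x hx => hx.2

/-- The squared distance of a point to the boundary of the ball of radius `R`, in units of `R`. -/
def ballWeight {E : Type*} [NormedAddCommGroup E] (R : ℝ) (z : E) : ℝ≥0∞ :=
  ENNReal.ofReal (1 - ‖z‖ / R) ^ 2

theorem unitMeasure_prod_le {t : ℝ} :
    (unitMeasure.prod unitMeasure) {p | t ≤ (1 - p.1 / 2) * (1 - p.2 / 2)} ≤
      4 * ENNReal.ofReal (1 - t) ^ 2 := by
  have hae : ∀ᵐ p ∂unitMeasure.prod unitMeasure, p ∈ Icc (0 : ℝ) 1 ×ˢ Icc (0 : ℝ) 1 := by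
    rw [unitMeasure, Measure.prod_restrict]
    exact ae_restrict_mem (measurableSet_Icc.prod measurableSet_Icc)
  calc _ ≤ (unitMeasure.prod unitMeasure) (Iic (2 * (1 - t)) ×ˢ Iic (2 * (1 - t))) := by
        refine measure_mono_ae ?_
        filter_upwards [hae] with p hp hpt
        obtain ⟨⟨h1, h2⟩, h3, h4⟩ := hp
        have hpt : t ≤ (1 - p.1 / 2) * (1 - p.2 / 2) := hpt
        refine ⟨?_, ?_⟩
        · change p.1 ≤ 2 * (1 - t)
          nlinarith [mul_nonneg h3 (sub_nonneg.2 h2)]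
        · change p.2 ≤ 2 * (1 - t)
          nlinarith [mul_nonneg h1 (sub_nonneg.2 h4)]
    _ ≤ ENNReal.ofReal (2 * (1 - t)) * ENNReal.ofReal (2 * (1 - t)) := by
        rw [Measure.prod_prod]
        gcongr <;> exact unitMeasure_Iic_le
    _ = _ := by
        rw [ENNReal.ofReal_mul zero_le_two, ENNReal.ofReal_ofNat]
        ring

theorem le_unitMeasure_prod {t : ℝ} (ht : 0 ≤ t) :
    ENNReal.ofReal (1 - t) ^ 2 ≤
      (unitMeasure.prod unitMeasure) {p | t ≤ (1 - p.1 / 2) * (1 - p.2 / 2)} := by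
  have hae : ∀ᵐ p ∂unitMeasure.prod unitMeasure, p ∈ Icc (0 : ℝ) 1 ×ˢ Icc (0 : ℝ) 1 := by
    rw [unitMeasure, Measure.prod_restrict]
    exact ae_restrict_mem (measurableSet_Icc.prod measurableSet_Icc)
  calc _ ≤ (unitMeasure.prod unitMeasure) (Iic (1 - t) ×ˢ Iic (1 - t)) := by
        rw [Measure.prod_prod, sq]
        gcongr <;> exact ofReal_le_unitMeasure_Iic (by linarith)
    _ ≤ _ := by
        refine measure_mono_ae ?_
        filter_upwards [hae] with p hp hpt
        obtain ⟨⟨h1, h2⟩, h3, h4⟩ := hp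
        obtain ⟨h5, h6⟩ := hpt
        have h5 : p.1 ≤ 1 - t := h5
        have h6 : p.2 ≤ 1 - t := h6
        change t ≤ (1 - p.1 / 2) * (1 - p.2 / 2)
        nlinarith [mul_nonneg h1 h3]

variable {E : Type*} [NormedAddCommGroup E] [NormedSpace ℝ E]

/-- Shrinking the ball of radius `R` by two independent factors. -/
def shrinkMap (R : ℝ) (w : (E × ℝ) × ℝ) : E :=
  (R * ((1 - w.1.2 / 2) * (1 - w.2 / 2))) • w.1.1

theorem lipschitzOnWith_shrinkMap {R : ℝ} (hR : 0 < R) :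
    LipschitzOnWith (2 * R).toNNReal (shrinkMap (E := E) R)
      ((closedBall 0 1 ×ˢ Icc 0 1) ×ˢ Icc 0 1) := by
  refine LipschitzOnWith.of_dist_le_mul ?_
  rintro ⟨⟨z, a⟩, b⟩ ⟨⟨hz, ha⟩, hb⟩ ⟨⟨z', a'⟩, b'⟩ ⟨⟨hz', ha'⟩, hb'⟩
  simp only [mem_closedBall_zero_iff, mem_Icc] at hz ha hb hz' ha' hb'
  set D := dist ((z, a), b) ((z', a'), b') with hD
  have h1 : ‖z - z'‖ ≤ D := by
    rw [← dist_eq_norm]; exact (le_max_left _ _).trans (le_max_left _ _)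
  have h2 : |a - a'| ≤ D := by
    rw [← Real.dist_eq]; exact (le_max_right _ _).trans (le_max_left _ _)
  have h3 : |b - b'| ≤ D := by
    rw [← Real.dist_eq]; exact le_max_right _ _
  have hD0 : 0 ≤ D := dist_nonneg
  rw [Real.coe_toNNReal _ (by positivity), dist_eq_norm]
  have key : shrinkMap R ((z, a), b) - shrinkMap R ((z', a'), b') =
      (R * ((1 - a / 2) * (1 - b / 2))) • (z - z') +
        (R * ((a' - a) / 2 * (1 - b / 2) + (1 - a' / 2) * ((b' - b) / 2))) • z' := by
    simp only [shrinkMap]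
    rw [smul_sub, show ∀ p q s : E, p - q = (p - s) + (s - q) from fun p q s => by abel]
    congr 1
    rw [← sub_smul]
    congr 1
    ring
  rw [key]
  refine (norm_add_le _ _).trans ?_
  rw [norm_smul, norm_smul, norm_mul R, norm_mul R, Real.norm_of_nonneg hR.le, Real.norm_eq_abs,
    Real.norm_eq_abs]
  have hk : |(1 - a / 2) * (1 - b / 2)| ≤ 1 := by
    rw [abs_of_nonneg (mul_nonneg (by linarith) (by linarith))]
    nlinarith
  have hk' : |(a' - a) / 2 * (1 - b / 2) + (1 - a' / 2) * ((b' - b) / 2)| ≤ D := by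
    refine (abs_add_le _ _).trans ?_
    rw [abs_mul, abs_mul, abs_of_nonneg (show 0 ≤ 1 - b / 2 by linarith),
      abs_of_nonneg (show 0 ≤ 1 - a' / 2 by linarith), abs_div, abs_div, abs_sub_comm a',
      abs_sub_comm b', abs_two]
    have e1 : |a - a'| / 2 * (1 - b / 2) ≤ D / 2 * 1 := by gcongr; linarith; linarith
    have e2 : (1 - a' / 2) * (|b - b'| / 2) ≤ 1 * (D / 2) := by gcongr; linarith
    linarith
  have e1 : R * |(1 - a / 2) * (1 - b / 2)| * ‖z - z'‖ ≤ R * 1 * D := by gcongr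
  have e2 : R * |(a' - a) / 2 * (1 - b / 2) + (1 - a' / 2) * ((b' - b) / 2)| * ‖z'‖ ≤ R * D * 1 := by
    gcongr
  linarith

instance (n : ℕ) : SFinite (μH[n] : Measure (EuclideanSpace ℝ (Fin n))) := by
  have h := isAddHaarMeasure_hausdorffMeasure (E := EuclideanSpace ℝ (Fin n))
  rw [finrank_euclideanSpace_fin] at h
  infer_instance

theorem prod_compl_eq_zero {X Y : Type*} [MeasurableSpace X] [MeasurableSpace Y] {μ : Measure X}
    {ν : Measure Y} [SFinite ν] {s : Set X} {t : Set Y} (hs : μ sᶜ = 0) (ht : ν tᶜ = 0) :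
    (μ.prod ν) (s ×ˢ t)ᶜ = 0 := by
  rw [compl_prod_eq_union]
  refine measure_union_null ?_ ?_ <;> simp [Measure.prod_prod, hs, ht]

open scoped Pointwise in
theorem hausdorffMeasure_preimage_smul_inter_ball (n : ℕ) {k : ℝ} (hk : 0 < k)
    (s : Set (EuclideanSpace ℝ (Fin n))) :
    ENNReal.ofReal (k ^ n) * μH[n] ((fun z => k • z) ⁻¹' s ∩ closedBall 0 1) =
      μH[n] (s ∩ closedBall 0 k) := by
  have h := Measure.hausdorffMeasure_smul₀ (d := n) (Nat.cast_nonneg n) hk.ne'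
    ((fun z => k • z) ⁻¹' s ∩ closedBall (0 : EuclideanSpace ℝ (Fin n)) 1)
  have hset : k • ((fun z => k • z) ⁻¹' s ∩ closedBall (0 : EuclideanSpace ℝ (Fin n)) 1) =
      s ∩ closedBall 0 k := by
    rw [smul_set_inter₀ hk.ne', _root_.smul_closedBall _ _ zero_le_one, smul_zero, mul_one,
      Real.norm_of_nonneg hk.le]
    congr 1
    rw [preimage_smul₀ hk.ne', smul_inv_smul₀ hk.ne']
  rw [hset, NNReal.rpow_natCast] at h
  rw [h, ENNReal.smul_def, smul_eq_mul, ENNReal.ofReal_pow hk.le, ENNReal.coe_pow]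
  congr 2
  exact (Real.enorm_of_nonneg hk.le).symm

theorem exists_chiSqTransport_ballWeight (n : ℕ) :
    ∃ K a b : ℝ≥0, ∀ R : ℝ, 0 < R → ∃ M : Measure (EuclideanSpace ℝ (Fin n)),
      IsProbabilityMeasure M ∧ ChiSqTransport M (ENNReal.ofReal (R ^ 2) * K) ∧
      (μH[n] : Measure (EuclideanSpace ℝ (Fin n))).withDensity (ballWeight R) ≤
        (ENNReal.ofReal (R ^ n) * a) • M ∧
      ENNReal.ofReal (R ^ n) • M ≤
        (b : ℝ≥0∞) • (μH[n] : Measure (EuclideanSpace ℝ (Fin n))).withDensity (ballWeight R) := by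
  obtain ⟨M₀, K, a, b, hprob, hball, hchi, hlow, hupp⟩ := exists_chiSqTransport_unitBall n
  refine ⟨4 * (K + 1 + 1), a, 4 ^ n * b * 4, fun R hR => ?_⟩
  set μ : Measure (EuclideanSpace ℝ (Fin n)) := μH[n]
  set P := unitMeasure.prod unitMeasure
  set T : (EuclideanSpace ℝ (Fin n) × ℝ) × ℝ → EuclideanSpace ℝ (Fin n) := shrinkMap R with hT
  have hTm : Measurable T := by
    have : Continuous T := by unfold T shrinkMap; fun_prop
    exact this.measurable
  have hchi' := (hchi.prod_unitMeasure.prod_unitMeasure).map hTm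
    ((measurableSet_closedBall.prod measurableSet_Icc).prod measurableSet_Icc)
    (lipschitzOnWith_shrinkMap hR)
    (prod_compl_eq_zero (prod_compl_eq_zero hball unitMeasure_compl) unitMeasure_compl)
  have hMs : ∀ s, MeasurableSet s → ((M₀.prod unitMeasure).prod unitMeasure).map T s =
      ∫⁻ p, M₀ ((fun z => (R * ((1 - p.1 / 2) * (1 - p.2 / 2))) • z) ⁻¹' s) ∂P := by
    intro s hs
    have hT'm : Measurable fun w : EuclideanSpace ℝ (Fin n) × ℝ × ℝ =>
        (R * ((1 - w.2.1 / 2) * (1 - w.2.2 / 2))) • w.1 := by fun_prop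
    have h := Measure.prod_apply_symm (μ := M₀) (ν := P) (hT'm hs)
    rw [← (measurePreserving_prodAssoc M₀ unitMeasure unitMeasure).measure_preimage
      (hT'm hs).nullMeasurableSet] at h
    rw [Measure.map_apply hTm hs]
    exact h
  have hweight : ∀ s, MeasurableSet s →
      ∫⁻ p, μ (s ∩ closedBall 0 (R * ((1 - p.1 / 2) * (1 - p.2 / 2)))) ∂P =
        ∫⁻ z in s, P {p | ‖z‖ / R ≤ (1 - p.1 / 2) * (1 - p.2 / 2)} ∂μ := by
    intro s hs
    have hm : MeasurableSet {w : EuclideanSpace ℝ (Fin n) × ℝ × ℝ |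
        ‖w.1‖ / R ≤ (1 - w.2.1 / 2) * (1 - w.2.2 / 2)} :=
      measurableSet_le (by fun_prop) (by fun_prop)
    have h1 := Measure.prod_apply (μ := μ.restrict s) (ν := P) hm
    rw [Measure.prod_apply_symm hm] at h1
    refine Eq.trans (lintegral_congr fun p => ?_) h1
    rw [Measure.restrict_apply (by measurability), inter_comm]
    congr 2
    ext z
    simp only [mem_closedBall_zero_iff, mem_preimage, mem_ofPred_eq]
    rw [div_le_iff₀ hR, mul_comm R]
  have hwint : ∀ s, MeasurableSet s →
      μ.withDensity (ballWeight R) s = ∫⁻ z in s, ENNReal.ofReal (1 - ‖z‖ / R) ^ 2 ∂μ :=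
    fun s hs => withDensity_apply _ hs
  have hPae : ∀ᵐ p ∂P, p ∈ Icc (0 : ℝ) 1 ×ˢ Icc (0 : ℝ) 1 :=
    measure_eq_zero_iff_ae_notMem.1 (prod_compl_eq_zero unitMeasure_compl unitMeasure_compl)
      |>.mono fun p hp => not_not.1 hp
  have hk : ∀ p ∈ Icc (0 : ℝ) 1 ×ˢ Icc (0 : ℝ) 1, 4⁻¹ ≤ (1 - p.1 / 2) * (1 - p.2 / 2) ∧
      (1 - p.1 / 2) * (1 - p.2 / 2) ≤ 1 := by
    rintro p ⟨⟨h1, h2⟩, h3, h4⟩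
    constructor <;> nlinarith [mul_nonneg h1 h3, mul_nonneg (sub_nonneg.2 h2) (sub_nonneg.2 h4)]
  refine ⟨((M₀.prod unitMeasure).prod unitMeasure).map T, Measure.isProbabilityMeasure_map hTm.aemeasurable, ?_, ?_, ?_⟩
  · convert hchi' using 1
    rw [← ENNReal.ofReal, ← ENNReal.ofReal_pow (by positivity), mul_pow,
      ENNReal.ofReal_mul (by positivity)]
    norm_num
    ring
  · refine Measure.le_iff.2 fun s hs => ?_
    rw [hwint s hs, Measure.smul_apply, smul_eq_mul, hMs s hs]
    calc _ ≤ ∫⁻ z in s, P {p | ‖z‖ / R ≤ (1 - p.1 / 2) * (1 - p.2 / 2)} ∂μ :=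
          lintegral_mono fun z => le_unitMeasure_prod (by positivity)
      _ = ∫⁻ p, μ (s ∩ closedBall 0 (R * ((1 - p.1 / 2) * (1 - p.2 / 2)))) ∂P := (hweight s hs).symm
      _ ≤ ∫⁻ p, (ENNReal.ofReal (R ^ n) * a) *
            M₀ ((fun z => (R * ((1 - p.1 / 2) * (1 - p.2 / 2))) • z) ⁻¹' s) ∂P := by
          refine lintegral_mono_ae ?_
          filter_upwards [hPae] with p hp
          obtain ⟨h1, h2⟩ := hk p hp
          rw [← hausdorffMeasure_preimage_smul_inter_ball n (by positivity), mul_assoc]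
          gcongr
          · exact mul_le_of_le_one_right hR.le h2
          · exact hlow _ (measurable_const_smul _ hs)
      _ = _ := lintegral_const_mul' _ _ (by finiteness)
  · refine Measure.le_iff.2 fun s hs => ?_
    rw [Measure.smul_apply, Measure.smul_apply, hwint s hs, smul_eq_mul, smul_eq_mul, hMs s hs,
      ← lintegral_const_mul' _ _ (by finiteness)]
    calc _ ≤ ∫⁻ p, ((4 ^ n * b : ℝ≥0) : ℝ≥0∞) *
            μ (s ∩ closedBall 0 (R * ((1 - p.1 / 2) * (1 - p.2 / 2)))) ∂P := by
          refine lintegral_mono_ae ?_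
          filter_upwards [hPae] with p hp
          obtain ⟨h1, h2⟩ := hk p hp
          have hk0 : 0 < (1 - p.1 / 2) * (1 - p.2 / 2) := lt_of_lt_of_le (by norm_num) h1
          rw [← hausdorffMeasure_preimage_smul_inter_ball n (by positivity)]
          refine (mul_le_mul_right (hupp _ (measurable_const_smul _ hs)) _).trans ?_
          have hRk : ENNReal.ofReal (R ^ n) ≤
              4 ^ n * ENNReal.ofReal ((R * ((1 - p.1 / 2) * (1 - p.2 / 2))) ^ n) := by
            rw [← ENNReal.ofReal_ofNat, ← ENNReal.ofReal_pow (by norm_num),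
              ← ENNReal.ofReal_mul (by positivity), ← mul_pow]
            gcongr
            nlinarith
          refine (mul_le_mul_left hRk _).trans_eq ?_
          rw [ENNReal.coe_mul, ENNReal.coe_pow, ENNReal.coe_ofNat]
          ring
      _ = ((4 ^ n * b : ℝ≥0) : ℝ≥0∞) *
            ∫⁻ z in s, P {p | ‖z‖ / R ≤ (1 - p.1 / 2) * (1 - p.2 / 2)} ∂μ := by
          rw [lintegral_const_mul' _ _ (by finiteness), hweight s hs]
      _ ≤ ((4 ^ n * b : ℝ≥0) : ℝ≥0∞) * ∫⁻ z in s, 4 * ENNReal.ofReal (1 - ‖z‖ / R) ^ 2 ∂μ := by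
          gcongr with z
          exact unitMeasure_prod_le
      _ = _ := by
          rw [lintegral_const_mul' _ _ (by finiteness), ← mul_assoc]
          simp

end Weighted

theorem exists_bounded_density {X : Type*} [MeasurableSpace X] {m M : Measure X}
    [IsFiniteMeasure m] [IsFiniteMeasure M] {b : ℝ≥0} (h : m ≤ (b : ℝ≥0∞) • M) :
    ∃ w : X → ℝ≥0, Measurable w ∧ (∀ x, w x ≤ b) ∧ m = M.withDensity fun x => (w x : ℝ≥0∞) := by
  have hac : m ≪ M := (Measure.absolutelyContinuous_of_le h).trans
    (Measure.smul_absolutelyContinuous)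
  have hle : m.rnDeriv M ≤ᵐ[M] fun _ => (b : ℝ≥0∞) := by
    refine ae_le_of_forall_setLIntegral_le_of_sigmaFinite (Measure.measurable_rnDeriv _ _)
      fun s hs _ => ?_
    rw [Measure.setLIntegral_rnDeriv hac, setLIntegral_const]
    exact h s
  have htop : ∀ x, min (m.rnDeriv M x) b ≠ ∞ := fun x =>
    ne_top_of_le_ne_top coe_ne_top (min_le_right _ _)
  refine ⟨fun x => (min (m.rnDeriv M x) b).toNNReal, ?_, fun x => ?_, ?_⟩
  · exact ((Measure.measurable_rnDeriv _ _).min measurable_const).ennreal_toNNReal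
  · rw [← ENNReal.coe_le_coe, ENNReal.coe_toNNReal (htop x)]
    exact min_le_right _ _
  · conv_lhs => rw [← Measure.withDensity_rnDeriv_eq m M hac]
    refine withDensity_congr_ae ?_
    filter_upwards [hle] with x hx
    rw [ENNReal.coe_toNNReal (htop x), min_eq_left hx]

section Perturbation

variable {X : Type*} [MeasurableSpace X] [PseudoEMetricSpace X] [OpensMeasurableSpace X]
  [SecondCountableTopology X] [StandardBorelSpace X] [Nonempty X]

theorem lintegral_coe_ne_top {Y : Type*} [MeasurableSpace Y] (ν : Measure Y) [IsFiniteMeasure ν]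
    {u : Y → ℝ≥0} {B : ℝ≥0} (hB : ∀ x, u x ≤ B) : ∫⁻ x, u x ∂ν ≠ ∞ := by
  refine ne_of_lt (lt_of_le_of_lt (lintegral_mono fun x => ENNReal.coe_le_coe.2 (hB x)) ?_)
  rw [lintegral_const]
  finiteness

theorem ChiSqTransport.W2sq_add_withDensity_le {M : Measure X} [IsFiniteMeasure M] {K : ℝ≥0∞}
    (h : ChiSqTransport M K) {u v : X → ℝ≥0} (hu : Measurable u) (hv : Measurable v) {B : ℝ≥0}
    (huB : ∀ x, u x ≤ B) (hvB : ∀ x, v x ≤ B) (huv : ∫⁻ x, u x ∂M = ∫⁻ x, v x ∂M) :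
    W2sq (M + M.withDensity fun x => (u x : ℝ≥0∞)) (M + M.withDensity fun x => (v x : ℝ≥0∞)) ≤
      3 * K * (∫⁻ x, (u x : ℝ≥0∞) ^ 2 ∂M + ∫⁻ x, (v x : ℝ≥0∞) ^ 2 ∂M) := by
  have hone : ∀ u : X → ℝ≥0, M + M.withDensity (fun x => (u x : ℝ≥0∞)) =
      M.withDensity fun x => (1 + u x : ℝ≥0∞) := fun u => by
    conv_rhs => rw [show (fun x => (1 + u x : ℝ≥0∞)) = 1 + fun x => (u x : ℝ≥0∞) from rfl,
      withDensity_add_left measurable_one, withDensity_one]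
  have hfin : ∀ u : X → ℝ≥0, (∀ x, u x ≤ B) →
      IsFiniteMeasure (M + M.withDensity fun x => (u x : ℝ≥0∞)) := fun u hu => by
    have := isFiniteMeasure_withDensity (lintegral_coe_ne_top M hu)
    infer_instance
  have := hfin u huB
  have := hfin v hvB
  obtain ⟨π, hπ, hc⟩ := h u hu ⟨B, huB⟩
  obtain ⟨π', hπ', hc'⟩ := h v hv ⟨B, hvB⟩
  rw [← hone] at hπ hπ'
  rw [← huv] at hπ'
  have hmid : IsFiniteMeasure ((1 + ∫⁻ x, u x ∂M) • M) :=
    Measure.smul_finite _ (ENNReal.add_ne_top.2 ⟨one_ne_top, lintegral_coe_ne_top M huB⟩)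
  refine (W2sq_triangle _ ((1 + ∫⁻ x, u x ∂M) • M) _).trans ?_
  calc _ ≤ 3 / 2 * (K * ∫⁻ x, (u x : ℝ≥0∞) ^ 2 ∂M) + 3 * (K * ∫⁻ x, (v x : ℝ≥0∞) ^ 2 ∂M) := by
        gcongr
        · exact (W2sq_le hπ).trans hc
        · rw [W2sq_comm]; exact (W2sq_le hπ').trans hc'
    _ ≤ 3 * (K * ∫⁻ x, (u x : ℝ≥0∞) ^ 2 ∂M) + 3 * (K * ∫⁻ x, (v x : ℝ≥0∞) ^ 2 ∂M) := by
        gcongr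
        exact ENNReal.div_le_of_le_mul (by norm_num)
    _ = _ := by ring

theorem W2sq_le_of_add_le {μ ν : Measure X} [IsFiniteMeasure μ] [IsFiniteMeasure ν] {w : ℝ≥0∞}
    (hfin : W2sq μ ν ≠ ∞) (h : W2sq (μ + ν) (ν + ν) ≤ w) : W2sq μ ν ≤ 6 * w := by
  have hhalf : ∀ μ : Measure X, (2⁻¹ : ℝ≥0∞) • (μ + μ) = μ := fun μ => by
    rw [← two_smul ℝ≥0∞, smul_smul, ENNReal.inv_mul_cancel (by norm_num) (by norm_num), one_smul]
  have h1 : W2sq μ ν ≤ 2⁻¹ * W2sq (μ + μ) (ν + ν) := by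
    conv_lhs => rw [← hhalf μ, ← hhalf ν]
    exact W2sq_smul_le _ (by simp) (by simp) _ _
  have h2 : W2sq (μ + μ) (ν + ν) ≤ 3 / 2 * W2sq μ ν + 3 * w := by
    refine (W2sq_triangle _ (μ + ν) _).trans ?_
    gcongr
    rw [add_comm μ ν]
    exact W2sq_add_right_le _ _ _
  rcases eq_or_ne w ∞ with rfl | hw
  · simp
  have h3 := h1.trans (mul_le_mul_right h2 _)
  lift W2sq μ ν to ℝ≥0 using hfin with a
  lift w to ℝ≥0 using hw
  have e1 : (2⁻¹ : ℝ≥0∞) = ((2⁻¹ : ℝ≥0) : ℝ≥0∞) := by simp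
  have e2 : (3 / 2 : ℝ≥0∞) = ((3 / 2 : ℝ≥0) : ℝ≥0∞) := by
    rw [ENNReal.coe_div (by norm_num)]; norm_num
  rw [e1, e2] at h3
  have h4 : a ≤ 2⁻¹ * (3 / 2 * a + 3 * w) := by exact_mod_cast h3
  have h5 : a ≤ 6 * w := by
    rw [← NNReal.coe_le_coe] at h4 ⊢
    push_cast at h4 ⊢
    linarith
  exact_mod_cast h5

theorem ChiSqTransport.W2sq_withDensity_le_of_lintegral_eq {M m : Measure X} [IsFiniteMeasure M]
    [IsFiniteMeasure m] {K : ℝ≥0∞} (h : ChiSqTransport M K) {a b : ℝ≥0} (ha : a ≠ 0)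
    (ham : (a : ℝ≥0∞) • M ≤ m) (hmb : m ≤ (b : ℝ≥0∞) • M) {v : X → ℝ≥0} (hv : Measurable v)
    {B : ℝ≥0} (hvB : ∀ x, v x ≤ B) (hmass : ∫⁻ x, v x ∂m = m univ)
    (hfin : W2sq (m.withDensity fun x => (v x : ℝ≥0∞)) m ≠ ∞) :
    W2sq (m.withDensity fun x => (v x : ℝ≥0∞)) m ≤
      18 * K * (b / a) * ∫⁻ x, ENNReal.ofReal ((v x - 1) ^ 2) ∂m := by
  have ha' : (a : ℝ≥0∞) ≠ 0 := by simpa using ha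
  obtain ⟨w, hw, hwb, hwm⟩ := exists_bounded_density hmb
  have hvfin := isFiniteMeasure_withDensity (lintegral_coe_ne_top m hvB)
  -- the positive and negative parts of `v - 1`
  set p : X → ℝ≥0 := fun x => v x - 1 with hp
  set q : X → ℝ≥0 := fun x => 1 - v x with hq
  have hpm : Measurable p := hv.sub_const 1
  have hqm : Measurable q := hv.const_sub 1
  have hpB : ∀ x, p x ≤ B + 1 := fun x => tsub_le_self.trans ((hvB x).trans le_self_add)
  have hqB : ∀ x, q x ≤ B + 1 := fun x => tsub_le_self.trans le_add_self
  have hmeas : ∀ f : X → ℝ≥0, Measurable f → Measurable fun x => (f x : ℝ≥0∞) := fun f hf => by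
    fun_prop
  have hvd : ∀ f g : X → ℝ≥0, Measurable f →
      m.withDensity (fun x => ((f x + g x : ℝ≥0) : ℝ≥0∞)) =
        m.withDensity (fun x => (f x : ℝ≥0∞)) + m.withDensity fun x => (g x : ℝ≥0∞) := by
    intro f g hf
    rw [← withDensity_add_left (hmeas f hf)]
    congr 1
  set e : Measure X := m.withDensity fun x => ((min (v x) 1 : ℝ≥0) : ℝ≥0∞) with he
  have hvp : m.withDensity (fun x => (v x : ℝ≥0∞)) = m.withDensity (fun x => (p x : ℝ≥0∞)) + e := by
    rw [he, ← hvd _ _ hpm]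
    congr 1; funext x
    rw [hp]
    congr 1
    exact (tsub_add_min).symm
  have h1q : m = m.withDensity (fun x => (q x : ℝ≥0∞)) + e := by
    rw [he, ← hvd _ _ hqm]
    conv_lhs => rw [← withDensity_one (μ := m)]
    congr 1; funext x
    rw [hq]
    simp only [Pi.one_apply]
    rw [min_comm, tsub_add_min, ENNReal.coe_one]
  have hpq : ∫⁻ x, p x ∂m = ∫⁻ x, q x ∂m := by
    have e1 := congrArg (fun μ : Measure X => μ univ) hvp
    have e2 := congrArg (fun μ : Measure X => μ univ) h1q
    simp only [Measure.add_apply, withDensity_apply _ MeasurableSet.univ, Measure.restrict_univ,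
      hmass] at e1 e2
    rw [e2] at e1
    refine ((ENNReal.add_left_inj ?_).1 e1).symm
    refine ne_top_of_le_ne_top (measure_ne_top m univ) ?_
    conv_rhs => rw [h1q]
    exact Measure.le_add_left le_rfl _
  have : IsFiniteMeasure ((a : ℝ≥0∞) • M) := Measure.smul_finite _ (by simp)
  have hk := Measure.sub_add_cancel_of_le ham
  set k := m - (a : ℝ≥0∞) • M
  -- densities relative to `M`
  have hrel : ∀ f : X → ℝ≥0, Measurable f → (a : ℝ≥0∞) • (M + M.withDensity fun x =>
      ((f x * w x / a : ℝ≥0) : ℝ≥0∞)) = (a : ℝ≥0∞) • M + m.withDensity fun x => (f x : ℝ≥0∞) := by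
    intro f hf
    rw [smul_add, ← withDensity_smul _ (by fun_prop), hwm,
      ← withDensity_mul _ (by fun_prop) (by fun_prop)]
    congr 2
    funext x
    simp only [Pi.smul_apply, smul_eq_mul, Pi.mul_apply]
    rw [← ENNReal.coe_mul, ← ENNReal.coe_mul]
    congr 1
    field_simp
  have hint : ∀ f : X → ℝ≥0, Measurable f → ∫⁻ x, ((f x * w x / a : ℝ≥0) : ℝ≥0∞) ∂M =
      (a : ℝ≥0∞)⁻¹ * ∫⁻ x, f x ∂m := by
    intro f hf
    rw [hwm, lintegral_withDensity_eq_lintegral_mul _ (by fun_prop) (by fun_prop),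
      ← lintegral_const_mul _ (by fun_prop)]
    refine lintegral_congr fun x => ?_
    rw [Pi.mul_apply, ← ENNReal.coe_mul, ← ENNReal.coe_inv ha, ← ENNReal.coe_mul]
    congr 1
    field_simp
  have hint2 : ∀ f : X → ℝ≥0, Measurable f → ∫⁻ x, ((f x * w x / a : ℝ≥0) : ℝ≥0∞) ^ 2 ∂M ≤
      (a : ℝ≥0∞)⁻¹ * (b / a) * ∫⁻ x, (f x : ℝ≥0∞) ^ 2 ∂m := by
    intro f hf
    conv_rhs => rw [hwm]
    rw [lintegral_withDensity_eq_lintegral_mul _ (by fun_prop) (by fun_prop),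
      ← lintegral_const_mul _ (by fun_prop)]
    refine lintegral_mono fun x => ?_
    rw [Pi.mul_apply, ← ENNReal.coe_inv ha, ← ENNReal.coe_div ha, ← ENNReal.coe_pow,
      ← ENNReal.coe_pow, ← ENNReal.coe_mul, ← ENNReal.coe_mul, ← ENNReal.coe_mul,
      ENNReal.coe_le_coe]
    calc (f x * w x / a) ^ 2 = a⁻¹ * (w x / a) * (w x * f x ^ 2) := by field_simp
      _ ≤ _ := by gcongr; exact hwb x
  have hbd : ∀ f : X → ℝ≥0, (∀ x, f x ≤ B + 1) → ∀ x, f x * w x / a ≤ (B + 1) * b / a :=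
    fun f hf x => by gcongr; exacts [hf x, hwb x]
  refine (W2sq_le_of_add_le hfin (w := a * (3 * K * (
    (a : ℝ≥0∞)⁻¹ * (b / a) * ∫⁻ x, (p x : ℝ≥0∞) ^ 2 ∂m +
    (a : ℝ≥0∞)⁻¹ * (b / a) * ∫⁻ x, (q x : ℝ≥0∞) ^ 2 ∂m))) ?_).trans_eq ?_
  · have e1 : m.withDensity (fun x => (v x : ℝ≥0∞)) + m =
        (a : ℝ≥0∞) • (M + M.withDensity fun x => ((p x * w x / a : ℝ≥0) : ℝ≥0∞)) + (e + k) := by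
      calc _ = (m.withDensity (fun x => (p x : ℝ≥0∞)) + e) + (k + (a : ℝ≥0∞) • M) := by
            rw [hvp, hk]
        _ = _ := by rw [hrel p hpm]; abel
    have e2 : m + m =
        (a : ℝ≥0∞) • (M + M.withDensity fun x => ((q x * w x / a : ℝ≥0) : ℝ≥0∞)) + (e + k) := by
      calc _ = (m.withDensity (fun x => (q x : ℝ≥0∞)) + e) + (k + (a : ℝ≥0∞) • M) := by
            rw [hk, ← h1q]
        _ = _ := by rw [hrel q hqm]; abel
    rw [e1, e2]
    refine (W2sq_add_right_le _ _ _).trans ((W2sq_smul_le _ ha' (by simp) _ _).trans ?_)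
    gcongr
    refine (h.W2sq_add_withDensity_le (by fun_prop) (by fun_prop) (hbd p hpB) (hbd q hqB)
      (by rw [hint p hpm, hint q hqm, hpq])).trans ?_
    gcongr
    · exact hint2 p hpm
    · exact hint2 q hqm
  · have hsq : ∫⁻ x, ENNReal.ofReal ((v x - 1) ^ 2) ∂m =
        ∫⁻ x, (p x : ℝ≥0∞) ^ 2 ∂m + ∫⁻ x, (q x : ℝ≥0∞) ^ 2 ∂m := by
      rw [← lintegral_add_left (by fun_prop)]
      refine lintegral_congr fun x => ?_
      rw [← ENNReal.ofReal_coe_nnreal, ← ENNReal.ofReal_coe_nnreal,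
        ← ENNReal.ofReal_pow (by positivity), ← ENNReal.ofReal_pow (by positivity),
        ← ENNReal.ofReal_add (by positivity) (by positivity)]
      congr 1
      rw [hp, hq]
      simp only [NNReal.coe_sub_def, NNReal.coe_one]
      rcases le_total (v x : ℝ) 1 with h1 | h1
      · rw [max_eq_right (by linarith), max_eq_left (by linarith)]; ring
      · rw [max_eq_left (by linarith), max_eq_right (by linarith)]; ring
    rw [hsq]
    have haa : (a : ℝ≥0∞) * (a : ℝ≥0∞)⁻¹ = 1 := ENNReal.mul_inv_cancel ha' (by simp)
    calc _ = (a * (a : ℝ≥0∞)⁻¹) * (18 * K * (b / a) *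
          (∫⁻ x, (p x : ℝ≥0∞) ^ 2 ∂m + ∫⁻ x, (q x : ℝ≥0∞) ^ 2 ∂m)) := by ring
      _ = _ := by rw [haa, one_mul]

end Perturbation

theorem lintegral_sq_sub_mean_le {X : Type*} [MeasurableSpace X] (m : Measure X)
    [IsFiniteMeasure m] {v : X → ℝ≥0} (hv : Measurable v) {B : ℝ≥0} (hvB : ∀ x, v x ≤ B)
    {c : ℝ≥0} (hmass : ∫⁻ x, v x ∂m = c * m univ) (a : ℝ) :
    ∫⁻ x, ENNReal.ofReal ((v x - c) ^ 2) ∂m ≤ ∫⁻ x, ENNReal.ofReal ((v x - a) ^ 2) ∂m := by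
  have hvr : Measurable fun x => (v x : ℝ) := by fun_prop
  have hi : Integrable (fun x => (v x : ℝ)) m :=
    Integrable.of_bound hvr.aestronglyMeasurable B (.of_forall fun x => by
      rw [Real.norm_of_nonneg (by positivity)]; exact_mod_cast hvB x)
  have hi2 : Integrable (fun x => (v x : ℝ) ^ 2) m :=
    Integrable.of_bound (by fun_prop) (B ^ 2) (.of_forall fun x => by
      rw [Real.norm_of_nonneg (by positivity)]
      have := NNReal.coe_le_coe.2 (hvB x)
      gcongr)
  have hexp : ∀ t : ℝ, (fun x => ((v x : ℝ) - t) ^ 2) =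
      fun x => ((v x : ℝ) ^ 2 + (-2 * t) * v x) + t ^ 2 := fun t => by funext x; ring
  have hit : ∀ t : ℝ, Integrable (fun x => ((v x : ℝ) - t) ^ 2) m := fun t => by
    rw [hexp]
    exact (hi2.add (hi.const_mul _)).add (integrable_const _)
  have hval : ∀ t : ℝ, ∫ x, ((v x : ℝ) - t) ^ 2 ∂m =
      ∫ x, (v x : ℝ) ^ 2 ∂m + (-2 * t) * ∫ x, (v x : ℝ) ∂m + t ^ 2 * m.real univ := fun t => by
    have hi1 : Integrable (fun x => (-2 * t) * (v x : ℝ)) m := hi.const_mul _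
    have hi3 : Integrable (fun x => (v x : ℝ) ^ 2 + (-2 * t) * v x) m := hi2.add hi1
    rw [hexp, integral_add hi3 (integrable_const _), integral_add hi2 hi1, integral_const_mul,
      integral_const, smul_eq_mul, mul_comm (m.real univ)]
  have hmean : ∫ x, (v x : ℝ) ∂m = c * m.real univ := by
    rw [integral_eq_lintegral_of_nonneg_ae (.of_forall fun x => by positivity)
      hvr.aestronglyMeasurable]
    simp only [ENNReal.ofReal_coe_nnreal, hmass, ENNReal.toReal_mul, ENNReal.coe_toReal]
    rfl
  rw [← ofReal_integral_eq_lintegral_ofReal (hit _) (.of_forall fun x => by positivity),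
    ← ofReal_integral_eq_lintegral_ofReal (hit _) (.of_forall fun x => by positivity)]
  refine ENNReal.ofReal_le_ofReal ?_
  rw [hval, hval, hmean]
  have : 0 ≤ m.real univ * (c - a) ^ 2 := by positivity
  linarith

theorem ChiSqTransport.W2sq_withDensity_le {X : Type*} [MeasurableSpace X] [PseudoEMetricSpace X]
    [OpensMeasurableSpace X] [SecondCountableTopology X] [StandardBorelSpace X] [Nonempty X]
    {M m : Measure X} [IsFiniteMeasure M]
    [IsFiniteMeasure m] {K : ℝ≥0∞} (h : ChiSqTransport M K) {a b : ℝ≥0} (ha : a ≠ 0)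
    (ham : (a : ℝ≥0∞) • M ≤ m) (hmb : m ≤ (b : ℝ≥0∞) • M) {v : X → ℝ≥0} (hv : Measurable v)
    {B : ℝ≥0} (hvB : ∀ x, v x ≤ B) {c : ℝ≥0} (hc : c ≠ 0) (hmass : ∫⁻ x, v x ∂m = c * m univ)
    (hfin : W2sq (m.withDensity fun x => (v x : ℝ≥0∞)) ((c : ℝ≥0∞) • m) ≠ ∞) (t : ℝ) :
    W2sq (m.withDensity fun x => (v x : ℝ≥0∞)) ((c : ℝ≥0∞) • m) ≤
      18 * K * (b / a) * (c : ℝ≥0∞)⁻¹ * ∫⁻ x, ENNReal.ofReal ((v x - t) ^ 2) ∂m := by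
  have hc' : (c : ℝ≥0∞) ≠ 0 := by simpa using hc
  have hcc : (c : ℝ≥0∞)⁻¹ * c = 1 := ENNReal.inv_mul_cancel hc' (by simp)
  set u : X → ℝ≥0 := fun x => c⁻¹ * v x with hu
  have hum : Measurable u := hv.const_mul _
  have hucoe : ∀ x, (u x : ℝ≥0∞) = (c : ℝ≥0∞)⁻¹ * v x := fun x => by
    simp only [hu]; rw [ENNReal.coe_mul, ENNReal.coe_inv hc]
  have huv : (m.withDensity fun x => (u x : ℝ≥0∞)) =
      (c : ℝ≥0∞)⁻¹ • m.withDensity fun x => (v x : ℝ≥0∞) := by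
    rw [← withDensity_smul _ (by fun_prop)]
    congr 1; funext x; exact hucoe x
  have hvu : (m.withDensity fun x => (v x : ℝ≥0∞)) =
      (c : ℝ≥0∞) • m.withDensity fun x => (u x : ℝ≥0∞) := by
    rw [huv, smul_smul, mul_comm, hcc, one_smul]
  have humass : ∫⁻ x, u x ∂m = m univ := by
    simp only [hucoe]
    rw [lintegral_const_mul _ (by fun_prop), hmass, ← mul_assoc, hcc, one_mul]
  have hufin : W2sq (m.withDensity fun x => (u x : ℝ≥0∞)) m ≠ ∞ := by
    refine ne_top_of_le_ne_top (ENNReal.mul_ne_top (ENNReal.inv_ne_top.2 hc') hfin) ?_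
    calc _ = W2sq ((c : ℝ≥0∞)⁻¹ • m.withDensity fun x => (v x : ℝ≥0∞))
          ((c : ℝ≥0∞)⁻¹ • (c : ℝ≥0∞) • m) := by
            rw [huv, smul_smul (c : ℝ≥0∞)⁻¹ (c : ℝ≥0∞) m, hcc, one_smul]
      _ ≤ _ := W2sq_smul_le _ (by simp) (by simpa using hc) _ _
  have hmain := h.W2sq_withDensity_le_of_lintegral_eq ha ham hmb hum (B := c⁻¹ * B)
    (fun x => by simp only [hu]; gcongr; exact hvB x) humass hufin
  rw [hvu]
  refine (W2sq_smul_le _ hc' (by simp) _ _).trans ((mul_le_mul_right hmain _).trans ?_)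
  have hsq : ∫⁻ x, ENNReal.ofReal ((u x - 1) ^ 2) ∂m =
      (c : ℝ≥0∞)⁻¹ ^ 2 * ∫⁻ x, ENNReal.ofReal ((v x - c) ^ 2) ∂m := by
    rw [← lintegral_const_mul _ (by fun_prop)]
    refine lintegral_congr fun x => ?_
    have hcr : (c : ℝ) ≠ 0 := by exact_mod_cast hc
    rw [← ENNReal.coe_inv hc, ← ENNReal.ofReal_coe_nnreal (p := c⁻¹),
      ← ENNReal.ofReal_pow (by positivity), ← ENNReal.ofReal_mul (by positivity)]
    congr 1
    simp only [hu]
    push_cast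
    field_simp
  rw [hsq]
  calc _ = ((c : ℝ≥0∞)⁻¹ * c) * (18 * K * (b / a) * (c : ℝ≥0∞)⁻¹ *
        ∫⁻ x, ENNReal.ofReal ((v x - c) ^ 2) ∂m) := by ring
    _ = 18 * K * (b / a) * (c : ℝ≥0∞)⁻¹ * ∫⁻ x, ENNReal.ofReal ((v x - c) ^ 2) ∂m := by
        rw [hcc, one_mul]
    _ ≤ _ := by
        gcongr 18 * K * (b / a) * (c : ℝ≥0∞)⁻¹ * ?_
        exact lintegral_sq_sub_mean_le m hv hvB hmass t

namespace IsBump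

variable {d : ℕ} {c₂ : ℝ} {φ : EuclideanSpace ℝ (Fin d) → ℝ}

theorem abs_deriv_radial_le (h : IsBump c₂ φ) (hc₂ : 0 ≤ c₂) {e : EuclideanSpace ℝ (Fin d)}
    (he : ‖e‖ = 1) {s : ℝ} (hs : 0 < s) (hs3 : s < 3) :
    |deriv (fun t : ℝ => φ (t • e)) s| ≤ c₂ * (3 - s) := by
  by_cases hd : DifferentiableAt ℝ (fun t : ℝ => φ (t • e)) s
  swap
  · rw [deriv_zero_of_not_differentiableAt hd, abs_zero]
    have : 0 ≤ 3 - s := by linarith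
    positivity
  have hne : ‖s • e‖ = s := by rw [norm_smul, he, mul_one, Real.norm_of_nonneg hs.le]
  have hrad : φ = (fun t : ℝ => φ (t • e)) ∘ fun y => ‖y‖ := by
    funext y
    refine h.2.1 _ _ ?_
    rw [norm_smul, he, mul_one, norm_norm]
  have hnorm : DifferentiableAt ℝ (fun y : EuclideanSpace ℝ (Fin d) => ‖y‖) (s • e) :=
    differentiableAt_id.norm ℝ (by rw [id, ← norm_ne_zero_iff, hne]; exact hs.ne')
  have hφ : DifferentiableAt ℝ φ (s • e) := by
    rw [hrad]
    exact DifferentiableAt.comp _ (by rw [hne]; exact hd) hnorm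
  have hder : HasDerivAt (fun t : ℝ => φ (t • e)) (fderiv ℝ φ (s • e) e) s := by
    have h1 : HasDerivAt (fun t : ℝ => t • e) e s := by
      simpa using (hasDerivAt_id s).smul_const e
    exact hφ.hasFDerivAt.comp_hasDerivAt s h1
  rw [hder.deriv, ← Real.norm_eq_abs]
  refine (ContinuousLinearMap.le_opNorm _ _).trans ?_
  rw [he, mul_one]
  simpa only [hne] using h.2.2.2.2.2.2 (s • e) (by rw [hne]; exact hs3) hφ

theorem abs_radial_sub_le (h : IsBump c₂ φ) (hc₂ : 0 ≤ c₂) {e : EuclideanSpace ℝ (Fin d)}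
    (he : ‖e‖ = 1) {a b : ℝ} (ha : 0 ≤ a) (ha3 : a ≤ 3) (hb : 0 ≤ b) (hb3 : b ≤ 3) :
    |φ (b • e) - φ (a • e)| ≤ c₂ * (3 - min a b) * |b - a| := by
  obtain ⟨K, hK⟩ := h.1
  have hline : LipschitzWith 1 fun t : ℝ => t • e :=
    LipschitzWith.of_dist_le_mul fun s t => by
      rw [dist_eq_norm, ← sub_smul, norm_smul, he, mul_one, NNReal.coe_one, one_mul, dist_eq_norm]
  have hac : AbsolutelyContinuousOnInterval (fun t : ℝ => φ (t • e)) a b :=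
    ((hK.comp hline).lipschitzOnWith (s := uIcc a b)).absolutelyContinuousOnInterval
  have hftc := hac.integral_deriv_eq_sub
  rw [← hftc, ← Real.norm_eq_abs]
  refine intervalIntegral.norm_integral_le_of_norm_le_const_ae ?_
  filter_upwards [Measure.ae_ne volume (3 : ℝ)] with s hs3 hs
  rw [uIoc, Set.mem_Ioc] at hs
  have h0 : 0 ≤ min a b := le_min ha hb
  have h3 : max a b ≤ 3 := max_le ha3 hb3
  refine (h.abs_deriv_radial_le hc₂ he (h0.trans_lt hs.1)
    (lt_of_le_of_ne (hs.2.trans h3) hs3)).trans ?_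
  gcongr
  exact hs.1.le

theorem abs_sub_le (h : IsBump c₂ φ) (hc₂ : 0 ≤ c₂) {x y : EuclideanSpace ℝ (Fin d)}
    (hxy : ‖x - y‖ ≤ 3 - ‖y‖) : |φ x - φ y| ≤ 2 * c₂ * ‖x - y‖ * (3 - ‖y‖) := by
  have hy : 0 ≤ 3 - ‖y‖ := (norm_nonneg _).trans hxy
  rcases subsingleton_or_nontrivial (EuclideanSpace ℝ (Fin d)) with hs | hs
  · rw [Subsingleton.elim x y, sub_self, abs_zero]
    positivity
  obtain ⟨e, he⟩ := exists_norm_eq (EuclideanSpace ℝ (Fin d)) zero_le_one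
  have hrad : ∀ z, φ z = φ (‖z‖ • e) := fun z =>
    h.2.1 _ _ (by rw [norm_smul, he, mul_one, norm_norm])
  have h1 : ‖x‖ ≤ ‖y‖ + ‖x - y‖ := by
    simpa using norm_add_le y (x - y)
  have h2 : |‖x‖ - ‖y‖| ≤ ‖x - y‖ := abs_norm_sub_norm_le x y
  rw [hrad x, hrad y]
  refine (h.abs_radial_sub_le hc₂ he (norm_nonneg _) (by linarith) (norm_nonneg _)
    (by linarith)).trans ?_
  have h3 : 3 - min ‖y‖ ‖x‖ ≤ 2 * (3 - ‖y‖) := by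
    have := abs_le.1 h2
    rcases min_choice ‖y‖ ‖x‖ with h | h <;> rw [h] <;> linarith [this.1]
  calc c₂ * (3 - min ‖y‖ ‖x‖) * |‖x‖ - ‖y‖| ≤ c₂ * (2 * (3 - ‖y‖)) * ‖x - y‖ := by gcongr
    _ = _ := by ring

end IsBump

/-- The normalized distance from `y` to the complement of the ball `3B`, where `B = B(x, r)`. -/
def depth {E : Type*} [PseudoMetricSpace E] (x : E) (r : ℝ) (y : E) : ℝ :=
  max (3 - dist y x / r) 0

section Depth

variable {E : Type*} [PseudoMetricSpace E] {x y u : E} {r : ℝ}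

theorem depth_nonneg : 0 ≤ depth x r y := le_max_right _ _

theorem depth_le_add (hr : 0 < r) : depth x r u ≤ depth x r y + dist u y / r := by
  have h1 : dist y x / r ≤ dist u x / r + dist u y / r := by
    rw [← add_div]
    gcongr
    rw [dist_comm u y, add_comm]
    exact dist_triangle _ _ _
  have h2 : 3 - dist y x / r ≤ depth x r y := le_max_left _ _
  have h3 : 0 ≤ dist u y / r := by positivity
  refine max_le (by linarith) (add_nonneg depth_nonneg h3)

theorem depth_eq_zero (hr : 0 < r) (hy : y ∉ closedBall x (3 * r)) : depth x r y = 0 := by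
  rw [mem_closedBall, not_le] at hy
  refine max_eq_right ?_
  rw [sub_nonpos, le_div_iff₀ hr]
  exact hy.le

theorem continuous_depth : Continuous (depth x r : E → ℝ) := by
  unfold depth
  fun_prop

end Depth

namespace IsBump

variable {d : ℕ} {c₂ : ℝ} {φ : EuclideanSpace ℝ (Fin d) → ℝ} {x y u : EuclideanSpace ℝ (Fin d)}
  {r : ℝ}

theorem continuous_phiB (h : IsBump c₂ φ) : Continuous (phiB φ x r) := by
  obtain ⟨K, hK⟩ := h.1
  have := hK.continuous
  unfold phiB
  fun_prop

theorem phiB_nonneg (h : IsBump c₂ φ) : 0 ≤ phiB φ x r y := (h.2.2.1 _).1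

theorem phiB_le_one (h : IsBump c₂ φ) : phiB φ x r y ≤ 1 := (h.2.2.1 _).2

theorem norm_inv_smul_sub (hr : 0 < r) : ‖r⁻¹ • (y - x)‖ = dist y x / r := by
  rw [norm_smul, norm_inv, Real.norm_of_nonneg hr.le, dist_eq_norm]
  ring

theorem phiB_eq_zero (h : IsBump c₂ φ) (hr : 0 < r) (hy : depth x r y = 0) :
    phiB φ x r y = 0 := by
  refine h.2.2.2.2.1 _ ?_
  rw [norm_inv_smul_sub hr]
  have : 3 - dist y x / r ≤ depth x r y := le_max_left _ _
  linarith

theorem phiB_eq_one (h : IsBump c₂ φ) (hr : 0 < r) (hy : y ∈ closedBall x r) :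
    phiB φ x r y = 1 := by
  refine h.2.2.2.1 _ ?_
  rw [norm_inv_smul_sub hr]
  refine ((div_le_one hr).2 hy).trans (by norm_num)

theorem phiB_bounds (h : IsBump c₂ φ) (hr : 0 < r) :
    c₂⁻¹ * depth x r y ^ 2 ≤ phiB φ x r y ∧ phiB φ x r y ≤ c₂ * depth x r y ^ 2 := by
  rcases lt_or_ge (dist y x / r) 3 with h3 | h3
  · have h1 := h.2.2.2.2.2.1 (r⁻¹ • (y - x)) (by rwa [norm_inv_smul_sub hr])
    rw [norm_inv_smul_sub hr] at h1
    rwa [depth, max_eq_left (by linarith)]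
  · have h0 : depth x r y = 0 := max_eq_right (by linarith)
    rw [h.phiB_eq_zero hr h0, h0]
    simp

theorem abs_phiB_sub_le (h : IsBump c₂ φ) (hc₂ : 0 ≤ c₂) (hr : 0 < r)
    (hu : dist u y / r ≤ depth x r y) :
    |phiB φ x r u - phiB φ x r y| ≤ 2 * c₂ * (dist u y / r) * depth x r y := by
  have h1 : dist u y / r = ‖r⁻¹ • (u - x) - r⁻¹ • (y - x)‖ := by
    rw [← smul_sub, sub_sub_sub_cancel_right, norm_inv_smul_sub hr]
  rcases lt_or_ge 0 (3 - dist y x / r) with h0 | h0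
  · have hd : depth x r y = 3 - ‖r⁻¹ • (y - x)‖ := by
      rw [depth, max_eq_left h0.le, norm_inv_smul_sub hr]
    rw [h1, hd] at hu ⊢
    exact h.abs_sub_le hc₂ hu
  · have hd : depth x r y = 0 := max_eq_right h0
    rw [hd, div_le_iff₀ hr, zero_mul] at hu
    rw [hd, dist_le_zero.1 hu]
    simp

theorem phiB_le_of_dist_le (h : IsBump c₂ φ) (hc₂ : 0 < c₂) (hr : 0 < r)
    (hu : dist u y / r ≤ depth x r y) : phiB φ x r u ≤ 4 * c₂ ^ 2 * phiB φ x r y := by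
  have h1 := (h.phiB_bounds (y := u) (x := x) hr).2
  have h2 := (h.phiB_bounds (y := y) (x := x) hr).1
  have h3 : depth x r u ≤ 2 * depth x r y := by linarith [depth_le_add (x := x) (y := y) (u := u) hr]
  have h4 := depth_nonneg (x := x) (r := r) (y := u)
  calc phiB φ x r u ≤ c₂ * depth x r u ^ 2 := h1
    _ ≤ c₂ * (2 * depth x r y) ^ 2 := by gcongr
    _ = 4 * c₂ ^ 2 * (c₂⁻¹ * depth x r y ^ 2) := by field_simp; ring
    _ ≤ _ := by gcongr

theorem phiB_le_of_lt_dist (h : IsBump c₂ φ) (hc₂ : 0 ≤ c₂) (hr : 0 < r)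
    (hu : depth x r y < dist u y / r) : phiB φ x r u ≤ 4 * c₂ * (dist u y / r) ^ 2 := by
  have h1 := (h.phiB_bounds (y := u) (x := x) hr).2
  have h3 : depth x r u ≤ 2 * (dist u y / r) := by
    linarith [depth_le_add (x := x) (y := y) (u := u) hr]
  have h4 := depth_nonneg (x := x) (r := r) (y := u)
  calc phiB φ x r u ≤ c₂ * depth x r u ^ 2 := h1
    _ ≤ c₂ * (2 * (dist u y / r)) ^ 2 := by gcongr
    _ = _ := by ring

/-- The truncated bump `1_G(u, y) φ_B(u)`, where `G` is the set of pairs whose distance is at most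
the distance of `y` to the complement of `3B`, is close to `φ_B(y)`. -/
theorem abs_ite_phiB_sub_le (h : IsBump c₂ φ) (hc₂ : 0 ≤ c₂) (hr : 0 < r) :
    |(if dist u y / r ≤ depth x r y then phiB φ x r u else 0) - phiB φ x r y| ≤
      2 * c₂ * (dist u y / r) * depth x r y := by
  split_ifs with hu
  · exact h.abs_phiB_sub_le hc₂ hr hu
  · rw [zero_sub, abs_neg, abs_of_nonneg h.phiB_nonneg]
    rw [not_le] at hu
    have h4 := depth_nonneg (x := x) (r := r) (y := y)
    calc phiB φ x r y ≤ c₂ * depth x r y ^ 2 := (h.phiB_bounds hr).2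
      _ = 1 * c₂ * depth x r y * depth x r y := by ring
      _ ≤ 2 * c₂ * (dist u y / r) * depth x r y := by gcongr; norm_num

end IsBump

theorem exists_isometry_range_eq {n d : ℕ} (L : AffineSubspace ℝ (EuclideanSpace ℝ (Fin d)))
    (hL : Module.finrank ℝ L.direction = n)
    (hne : (L : Set (EuclideanSpace ℝ (Fin d))).Nonempty) (x : EuclideanSpace ℝ (Fin d)) :
    ∃ ι : EuclideanSpace ℝ (Fin n) → EuclideanSpace ℝ (Fin d), Isometry ι ∧
      range ι = (L : Set (EuclideanSpace ℝ (Fin d))) ∧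
      ∃ h : ℝ, ∀ z, dist (ι z) x ^ 2 = ‖z‖ ^ 2 + h ^ 2 := by
  have : Nonempty L := hne.to_subtype
  set p : EuclideanSpace ℝ (Fin d) :=
    ((EuclideanGeometry.orthogonalProjection L x : L) : EuclideanSpace ℝ (Fin d)) with hp
  have hpL : p ∈ L := EuclideanGeometry.orthogonalProjection_mem x
  have horth : x - p ∈ L.directionᗮ :=
    EuclideanGeometry.vsub_orthogonalProjection_mem_direction_orthogonal L x
  let J : EuclideanSpace ℝ (Fin n) ≃ₗᵢ[ℝ] L.direction :=
    ((stdOrthonormalBasis ℝ L.direction).reindex (finCongr hL)).repr.symm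
  have hJ : ∀ z, ‖(J z : EuclideanSpace ℝ (Fin d))‖ = ‖z‖ := J.norm_map
  refine ⟨fun z => (J z : EuclideanSpace ℝ (Fin d)) + p, ?_, ?_, ‖x - p‖, fun z => ?_⟩
  · refine Isometry.of_dist_eq fun z w => ?_
    rw [dist_add_right, dist_eq_norm, ← Submodule.coe_sub, ← map_sub, hJ, dist_eq_norm]
  · ext y
    constructor
    · rintro ⟨z, rfl⟩
      exact AffineSubspace.vadd_mem_of_mem_direction (J z).2 hpL
    · intro hy
      refine ⟨J.symm ⟨y - p, AffineSubspace.vsub_mem_direction hy hpL⟩, ?_⟩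
      simp
  · have h0 : inner ℝ (J z : EuclideanSpace ℝ (Fin d)) (x - p) = 0 :=
      (Submodule.mem_orthogonal _ _).1 horth _ (J z).2
    have h1 := norm_sub_mul_self_real (J z : EuclideanSpace ℝ (Fin d)) (x - p)
    rw [h0, hJ] at h1
    rw [dist_eq_norm, show (J z : EuclideanSpace ℝ (Fin d)) + p - x = J z - (x - p) by abel]
    linarith

theorem depth_bounds {r h t R D : ℝ} (hr : 0 < r) (ht : 0 ≤ t) (hh : h ^ 2 ≤ r ^ 2) (hR : 0 < R)
    (hR2 : R ^ 2 = 9 * r ^ 2 - h ^ 2) (hD : 0 ≤ D) (hD2 : D ^ 2 = t ^ 2 + h ^ 2) :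
    2 / 3 * max (1 - t / R) 0 ≤ max (3 - D / r) 0 ∧
      max (3 - D / r) 0 ≤ 6 * max (1 - t / R) 0 := by
  have h2R : 2 * r ≤ R := by nlinarith
  have hR3 : R ≤ 3 * r := by nlinarith [sq_nonneg h]
  rcases le_total t R with htR | htR
  · have hD3 : D ≤ 3 * r := by nlinarith
    have e1 : 1 - t / R = (R - t) / R := by field_simp
    have e2 : 3 - D / r = (R - t) * (R + t) / ((3 * r + D) * r) := by
      rw [_root_.eq_div_iff (by positivity)]
      field_simp
      nlinarith
    have hw : 0 ≤ (R - t) / R := div_nonneg (by linarith) hR.le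
    have hw' : 0 ≤ 3 - D / r := by rw [sub_nonneg, div_le_iff₀ hr]; exact hD3
    rw [max_eq_left hw', e1, max_eq_left hw, e2]
    have hRt : 0 ≤ R - t := by linarith
    constructor
    · calc 2 / 3 * ((R - t) / R) = (R - t) * (2 / (3 * R)) := by field_simp
        _ ≤ (R - t) * ((R + t) / ((3 * r + D) * r)) := by
          refine mul_le_mul_of_nonneg_left ?_ hRt
          rw [div_le_div_iff₀ (by positivity) (by positivity)]
          nlinarith [mul_pos hr hR]
        _ = _ := by ring
    · calc (R - t) * (R + t) / ((3 * r + D) * r) = (R - t) * ((R + t) / ((3 * r + D) * r)) := by ring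
        _ ≤ (R - t) * (6 / R) := by
          refine mul_le_mul_of_nonneg_left ?_ hRt
          rw [div_le_div_iff₀ (by positivity) (by positivity)]
          nlinarith [mul_pos hr hR, mul_nonneg hD hr.le]
        _ = _ := by ring
  · have hD3 : 3 * r ≤ D := by nlinarith
    have e1 : 1 - t / R ≤ 0 := by rw [sub_nonpos, le_div_iff₀ hR]; linarith
    have e2 : 3 - D / r ≤ 0 := by rw [sub_nonpos, le_div_iff₀ hr]; exact hD3
    rw [max_eq_right e1, max_eq_right e2]
    simp

/-- The measure `φ_B ℋⁿ⌊L`. -/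
def bumpMeasure {d : ℕ} (n : ℕ) (φ : EuclideanSpace ℝ (Fin d) → ℝ)
    (x : EuclideanSpace ℝ (Fin d)) (r : ℝ)
    (L : AffineSubspace ℝ (EuclideanSpace ℝ (Fin d))) :
    Measure (EuclideanSpace ℝ (Fin d)) :=
  ((μH[(n:ℝ)]).restrict (L : Set (EuclideanSpace ℝ (Fin d)))).withDensity
    fun y => ENNReal.ofReal (phiB φ x r y)

theorem ChiSqTransport.mono {X : Type*} [MeasurableSpace X] [PseudoEMetricSpace X]
    {ν : Measure X} {K K' : ℝ≥0∞} (h : ChiSqTransport ν K) (hK : K ≤ K') : ChiSqTransport ν K' :=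
  fun u hu hM =>
    let ⟨π, hπ, hc⟩ := h u hu hM
    ⟨π, hπ, hc.trans (by gcongr)⟩

theorem map_withDensity_comp {X Y : Type*} [MeasurableSpace X] [MeasurableSpace Y]
    (μ : Measure X) {T : X → Y} (hT : Measurable T) {g : Y → ℝ≥0∞} (hg : Measurable g) :
    (μ.withDensity (g ∘ T)).map T = (μ.map T).withDensity g := by
  ext s hs
  rw [Measure.map_apply hT hs, withDensity_apply _ (hT hs), withDensity_apply _ hs,
    Measure.restrict_map hT hs, lintegral_map hg hT]
  rfl

theorem withDensity_le_const_smul {X : Type*} [MeasurableSpace X] (μ : Measure X)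
    {f g : X → ℝ≥0∞} (hg : Measurable g) {c : ℝ≥0∞} (h : ∀ x, f x ≤ c * g x) :
    μ.withDensity f ≤ c • μ.withDensity g := by
  rw [← withDensity_smul _ hg]
  exact withDensity_mono (.of_forall h)

theorem measurable_ballWeight {E : Type*} [NormedAddCommGroup E] [MeasurableSpace E]
    [OpensMeasurableSpace E] {R : ℝ} : Measurable (ballWeight R : E → ℝ≥0∞) := by
  unfold ballWeight
  fun_prop

/-- The flat bump measure `φ_B ℋⁿ⌊L` is comparable to a measure satisfying a transport
inequality at scale `r`. -/
theorem exists_chiSqTransport_bumpMeasure (n : ℕ) {c₂ : ℝ} (hc₂ : 0 < c₂) :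
    ∃ K a b : ℝ≥0, a ≠ 0 ∧ ∀ (d : ℕ) (φ : EuclideanSpace ℝ (Fin d) → ℝ), IsBump c₂ φ →
      ∀ (x : EuclideanSpace ℝ (Fin d)) (r : ℝ), 0 < r →
      ∀ L : AffineSubspace ℝ (EuclideanSpace ℝ (Fin d)), Module.finrank ℝ L.direction = n →
        ((L : Set (EuclideanSpace ℝ (Fin d))) ∩ closedBall x r).Nonempty →
      ∃ M : Measure (EuclideanSpace ℝ (Fin d)), IsProbabilityMeasure M ∧
        ChiSqTransport M (ENNReal.ofReal (r ^ 2) * K) ∧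
        (ENNReal.ofReal (r ^ n) * a) • M ≤ bumpMeasure n φ x r L ∧
        bumpMeasure n φ x r L ≤ (ENNReal.ofReal (r ^ n) * b) • M := by
  obtain ⟨K, a, b, hM⟩ := exists_chiSqTransport_ballWeight n
  refine ⟨9 * K, (b * (c₂ * (9 / 4)).toNNReal + 1)⁻¹, (c₂ * 36).toNNReal * (3 ^ n * a),
    by positivity, fun d φ hφ x r hr L hL hne => ?_⟩
  obtain ⟨ι, hι, hιL, h, hιd⟩ := exists_isometry_range_eq L hL (hne.mono inter_subset_left) x
  have hh : h ^ 2 ≤ r ^ 2 := by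
    obtain ⟨q, hq, hqx⟩ := hne
    rw [← hιL] at hq
    obtain ⟨z, rfl⟩ := hq
    have h1 := hιd z
    have h2 : dist (ι z) x ^ 2 ≤ r ^ 2 := by gcongr; exact hqx
    nlinarith [sq_nonneg ‖z‖]
  set R := √(9 * r ^ 2 - h ^ 2) with hRdef
  have hR2 : R ^ 2 = 9 * r ^ 2 - h ^ 2 := Real.sq_sqrt (by nlinarith)
  have hR : 0 < R := Real.sqrt_pos.2 (by nlinarith)
  have h2R : 2 * r ≤ R := by nlinarith
  have hR3 : R ≤ 3 * r := by nlinarith [sq_nonneg h]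
  obtain ⟨M, hMp, hMc, hMl, hMu⟩ := hM R hR
  have hιm : Measurable ι := hι.continuous.measurable
  set ψ : EuclideanSpace ℝ (Fin d) → ℝ≥0∞ := fun y => ENNReal.ofReal (phiB φ x r y) with hψ
  have hψm : Measurable ψ := hφ.continuous_phiB.measurable.ennreal_ofReal
  set m₀ : Measure (EuclideanSpace ℝ (Fin n)) := (μH[n]).withDensity (ψ ∘ ι) with hm₀
  have hm : bumpMeasure n φ x r L = m₀.map ι := by
    rw [hm₀, map_withDensity_comp _ hιm hψm, hι.map_hausdorffMeasure (.inl (by positivity)), hιL]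
    rfl
  have hbw : ∀ z : EuclideanSpace ℝ (Fin n), ballWeight R z =
      ENNReal.ofReal (max (1 - ‖z‖ / R) 0 ^ 2) := fun z => by
    rw [ballWeight, ENNReal.ofReal_pow (le_max_right _ _), ENNReal.ofReal_max]
    simp
  have hdep : ∀ z, 2 / 3 * max (1 - ‖z‖ / R) 0 ≤ depth x r (ι z) ∧
      depth x r (ι z) ≤ 6 * max (1 - ‖z‖ / R) 0 := fun z =>
    depth_bounds hr (norm_nonneg _) hh hR hR2 dist_nonneg (hιd z)
  have hup : ∀ z, (ψ ∘ ι) z ≤ ((c₂ * 36).toNNReal : ℝ≥0∞) * ballWeight R z := fun z => by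
    change ENNReal.ofReal _ ≤ ENNReal.ofReal _ * _
    rw [hbw, ← ENNReal.ofReal_mul (by positivity)]
    refine ENNReal.ofReal_le_ofReal ((hφ.phiB_bounds hr).2.trans ?_)
    calc c₂ * depth x r (ι z) ^ 2 ≤ c₂ * (6 * max (1 - ‖z‖ / R) 0) ^ 2 := by
          have := depth_nonneg (x := x) (r := r) (y := ι z)
          gcongr
          exact (hdep z).2
      _ = _ := by ring
  have hlow : ∀ z, ballWeight R z ≤ ((c₂ * (9 / 4)).toNNReal : ℝ≥0∞) * (ψ ∘ ι) z := fun z => by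
    change _ ≤ ENNReal.ofReal _ * ENNReal.ofReal _
    rw [hbw, ← ENNReal.ofReal_mul (by positivity)]
    refine ENNReal.ofReal_le_ofReal ?_
    calc max (1 - ‖z‖ / R) 0 ^ 2 = c₂ * (9 / 4) * (c₂⁻¹ * (2 / 3 * max (1 - ‖z‖ / R) 0) ^ 2) := by
          field_simp; ring
      _ ≤ c₂ * (9 / 4) * (c₂⁻¹ * depth x r (ι z) ^ 2) := by
          have := le_max_right (1 - ‖z‖ / R) 0
          gcongr
          exact (hdep z).1
      _ ≤ _ := by gcongr; exact (hφ.phiB_bounds hr).1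
  have hsmul : ∀ (c : ℝ≥0∞) {σ τ : Measure (EuclideanSpace ℝ (Fin n))}, σ ≤ τ → c • σ ≤ c • τ :=
    fun c σ τ h s => mul_le_mul_right (h s) c
  have hm₀l : (ENNReal.ofReal (r ^ n) * ((b * (c₂ * (9 / 4)).toNNReal + 1)⁻¹ : ℝ≥0)) • M ≤ m₀ := by
    set q : ℝ≥0 := b * (c₂ * (9 / 4)).toNNReal + 1 with hq
    have hq0 : q ≠ 0 := by positivity
    have h1 : ENNReal.ofReal (r ^ n) • M ≤ (q : ℝ≥0∞) • m₀ := by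
      calc ENNReal.ofReal (r ^ n) • M ≤ ENNReal.ofReal (R ^ n) • M := by
            refine fun s => mul_le_mul_left (ENNReal.ofReal_le_ofReal ?_) _
            gcongr
            linarith
        _ ≤ _ := hMu
        _ ≤ (b : ℝ≥0∞) • ((c₂ * (9 / 4)).toNNReal : ℝ≥0∞) • m₀ :=
            hsmul _ (withDensity_le_const_smul _ (hψm.comp hιm) hlow)
        _ ≤ _ := by
            rw [smul_smul, ← ENNReal.coe_mul]
            exact fun s => mul_le_mul_left (ENNReal.coe_le_coe.2 le_self_add) _
    calc _ = (q : ℝ≥0∞)⁻¹ • ENNReal.ofReal (r ^ n) • M := by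
          rw [smul_smul, mul_comm, ENNReal.coe_inv hq0]
      _ ≤ (q : ℝ≥0∞)⁻¹ • (q : ℝ≥0∞) • m₀ := hsmul _ h1
      _ = m₀ := by
          rw [smul_smul, ENNReal.inv_mul_cancel (by simpa using hq0) (by simp), one_smul]
  have hm₀u : m₀ ≤ (ENNReal.ofReal (r ^ n) * ((c₂ * 36).toNNReal * (3 ^ n * a) : ℝ≥0)) • M := by
    calc m₀ ≤ ((c₂ * 36).toNNReal : ℝ≥0∞) • (μH[n]).withDensity (ballWeight R) :=
          withDensity_le_const_smul _ measurable_ballWeight hup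
      _ ≤ ((c₂ * 36).toNNReal : ℝ≥0∞) • (ENNReal.ofReal (R ^ n) * a) • M := hsmul _ hMl
      _ ≤ _ := by
          rw [smul_smul]
          refine fun s => mul_le_mul_left ?_ _
          calc ((c₂ * 36).toNNReal : ℝ≥0∞) * (ENNReal.ofReal (R ^ n) * a) ≤
                ((c₂ * 36).toNNReal : ℝ≥0∞) * (ENNReal.ofReal ((3 * r) ^ n) * a) := by gcongr
            _ = _ := by
              rw [mul_pow, ENNReal.ofReal_mul (by positivity), ENNReal.ofReal_pow (by norm_num)]
              push_cast
              rw [ENNReal.ofReal_ofNat]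
              ring
  have := Measure.isProbabilityMeasure_map (μ := M) hιm.aemeasurable
  refine ⟨M.map ι, this, ?_, ?_, ?_⟩
  · have h1 := hMc.map hιm (A := 1) MeasurableSet.univ (hι.lipschitz.lipschitzOnWith) (by simp)
    refine h1.mono ?_
    rw [ENNReal.coe_one, one_pow, one_mul]
    push_cast
    rw [← mul_assoc]
    gcongr
    rw [← ENNReal.ofReal_ofNat 9, ← ENNReal.ofReal_mul (by positivity)]
    refine ENNReal.ofReal_le_ofReal ?_
    nlinarith [sq_nonneg h]
  · rw [hm, ← Measure.map_smul]
    exact Measure.map_mono hm₀l hιm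
  · rw [hm, ← Measure.map_smul]
    exact Measure.map_mono hm₀u hιm

section Truncation

variable {d : ℕ}

/-- The part of `φ_B` at `z.1` carried by the pairs that are at most as far apart as `z.2` is from
the complement of `3B`. -/
def nearWeight (φ : EuclideanSpace ℝ (Fin d) → ℝ) (x : EuclideanSpace ℝ (Fin d)) (r : ℝ)
    (z : EuclideanSpace ℝ (Fin d) × EuclideanSpace ℝ (Fin d)) : ℝ :=
  if dist z.1 z.2 / r ≤ depth x r z.2 then phiB φ x r z.1 else 0

/-- The part of `φ_B` at `z.1` carried by the pairs that are farther apart than `z.2` is from the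
complement of `3B`. -/
def farWeight (φ : EuclideanSpace ℝ (Fin d) → ℝ) (x : EuclideanSpace ℝ (Fin d)) (r : ℝ)
    (z : EuclideanSpace ℝ (Fin d) × EuclideanSpace ℝ (Fin d)) : ℝ :=
  if dist z.1 z.2 / r ≤ depth x r z.2 then 0 else phiB φ x r z.1

variable {φ : EuclideanSpace ℝ (Fin d) → ℝ} {c₂ : ℝ} {x : EuclideanSpace ℝ (Fin d)} {r : ℝ}
  {z : EuclideanSpace ℝ (Fin d) × EuclideanSpace ℝ (Fin d)}

theorem measurableSet_near : MeasurableSet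
    {z : EuclideanSpace ℝ (Fin d) × EuclideanSpace ℝ (Fin d) |
      dist z.1 z.2 / r ≤ depth x r z.2} := by
  have h1 : Continuous (depth x r : EuclideanSpace ℝ (Fin d) → ℝ) := continuous_depth
  exact (isClosed_le (by fun_prop) (by fun_prop)).measurableSet

namespace IsBump

theorem measurable_nearWeight (h : IsBump c₂ φ) : Measurable (nearWeight φ x r) := by
  have h1 : Continuous (phiB φ x r) := h.continuous_phiB
  exact Measurable.ite measurableSet_near (by fun_prop) measurable_const

theorem measurable_farWeight (h : IsBump c₂ φ) : Measurable (farWeight φ x r) := by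
  have h1 : Continuous (phiB φ x r) := h.continuous_phiB
  exact Measurable.ite measurableSet_near measurable_const (by fun_prop)

theorem nearWeight_add_farWeight :
    ENNReal.ofReal (nearWeight φ x r z) + ENNReal.ofReal (farWeight φ x r z) =
      ENNReal.ofReal (phiB φ x r z.1) := by
  unfold nearWeight farWeight
  split_ifs <;> simp

theorem nearWeight_nonneg (h : IsBump c₂ φ) : 0 ≤ nearWeight φ x r z := by
  unfold nearWeight
  split_ifs
  exacts [h.phiB_nonneg, le_rfl]

theorem nearWeight_le_one (h : IsBump c₂ φ) : nearWeight φ x r z ≤ 1 := by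
  unfold nearWeight
  split_ifs
  exacts [h.phiB_le_one, zero_le_one]

theorem nearWeight_le (h : IsBump c₂ φ) (hc₂ : 0 < c₂) (hr : 0 < r) :
    nearWeight φ x r z ≤ 4 * c₂ ^ 2 * phiB φ x r z.2 := by
  unfold nearWeight
  split_ifs with hz
  · exact h.phiB_le_of_dist_le hc₂ hr hz
  · have := h.phiB_nonneg (x := x) (r := r) (y := z.2)
    positivity

theorem farWeight_le (h : IsBump c₂ φ) (hc₂ : 0 < c₂) (hr : 0 < r) :
    farWeight φ x r z ≤ 4 * c₂ / r ^ 2 * dist z.1 z.2 ^ 2 := by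
  unfold farWeight
  split_ifs with hz
  · positivity
  · refine (h.phiB_le_of_lt_dist hc₂.le hr (not_le.1 hz)).trans_eq ?_
    ring

theorem sq_nearWeight_sub_le (h : IsBump c₂ φ) (hc₂ : 0 < c₂) (hr : 0 < r) :
    (nearWeight φ x r z - phiB φ x r z.2) ^ 2 ≤
      4 * c₂ ^ 3 / r ^ 2 * phiB φ x r z.2 * dist z.1 z.2 ^ 2 := by
  have h1 := h.abs_ite_phiB_sub_le (x := x) (u := z.1) (y := z.2) hc₂.le hr
  have h2 := (h.phiB_bounds (x := x) (y := z.2) hr).1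
  calc (nearWeight φ x r z - phiB φ x r z.2) ^ 2
      = |nearWeight φ x r z - phiB φ x r z.2| ^ 2 := (sq_abs _).symm
    _ ≤ (2 * c₂ * (dist z.1 z.2 / r) * depth x r z.2) ^ 2 := by gcongr; exact h1
    _ = 4 * c₂ ^ 3 / r ^ 2 * (c₂⁻¹ * depth x r z.2 ^ 2) * dist z.1 z.2 ^ 2 := by field_simp; ring
    _ ≤ _ := by gcongr

/-- The second marginal of a coupling, weighted by `nearWeight`, is a bounded density with respect
to `φ_B ν`, and the variance of that density is controlled by the cost of the coupling. -/
theorem exists_density_nearWeight (h : IsBump c₂ φ) (hc₂ : 0 < c₂) (hr : 0 < r)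
    (π : Measure (EuclideanSpace ℝ (Fin d) × EuclideanSpace ℝ (Fin d))) [IsFiniteMeasure π]
    {m : Measure (EuclideanSpace ℝ (Fin d))}
    (hm : m = (π.map Prod.snd).withDensity fun y => ENNReal.ofReal (phiB φ x r y)) :
    ∃ v : EuclideanSpace ℝ (Fin d) → ℝ≥0, Measurable v ∧
      (∀ y, v y ≤ (4 * c₂ ^ 2).toNNReal) ∧
      (π.withDensity fun z => ENNReal.ofReal (nearWeight φ x r z)).map Prod.snd =
        m.withDensity (fun y => (v y : ℝ≥0∞)) ∧
      ∫⁻ y, ENNReal.ofReal ((v y - 1) ^ 2) ∂m ≤ ENNReal.ofReal (4 * c₂ ^ 3 / r ^ 2) * sqCost π := by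
  set π' := π.map Prod.swap with hπ'
  set κ := π'.condKernel with hκ
  have hψm : Measurable (phiB φ x r) := h.continuous_phiB.measurable
  have hFm : Measurable (nearWeight φ x r) := h.measurable_nearWeight
  have hfst : π'.fst = π.map Prod.snd := by
    rw [Measure.fst, hπ', Measure.map_map measurable_fst measurable_swap]
    rfl
  have hdis : ∀ g : EuclideanSpace ℝ (Fin d) × EuclideanSpace ℝ (Fin d) → ℝ≥0∞, Measurable g →
      ∫⁻ z, g z ∂π = ∫⁻ y, ∫⁻ u, g (u, y) ∂κ y ∂(π.map Prod.snd) := fun g hg => by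
    have hgs : Measurable fun w : EuclideanSpace ℝ (Fin d) × EuclideanSpace ℝ (Fin d) =>
        g w.swap := hg.comp measurable_swap
    have h1 : ∫⁻ z, g z ∂π = ∫⁻ w, g w.swap ∂π' := by
      rw [hπ', lintegral_map hgs measurable_swap]
      simp
    rw [h1, ← π'.disintegrate κ, Measure.lintegral_compProd hgs, hfst]
    rfl
  set V : EuclideanSpace ℝ (Fin d) → ℝ≥0∞ := fun y =>
    ∫⁻ u, ENNReal.ofReal (nearWeight φ x r (u, y)) ∂κ y with hV
  have hVm : Measurable V := by
    have h1 : Measurable (Function.uncurry fun y u => ENNReal.ofReal (nearWeight φ x r (u, y))) := by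
      change Measurable fun p : EuclideanSpace ℝ (Fin d) × EuclideanSpace ℝ (Fin d) =>
        ENNReal.ofReal (nearWeight φ x r (p.2, p.1))
      fun_prop
    exact h1.lintegral_kernel_prod_right
  have hVle : ∀ y, V y ≤ ENNReal.ofReal (4 * c₂ ^ 2) * ENNReal.ofReal (phiB φ x r y) := fun y => by
    rw [← ENNReal.ofReal_mul (by positivity)]
    refine (lintegral_mono fun u => ENNReal.ofReal_le_ofReal (h.nearWeight_le hc₂ hr)).trans_eq ?_
    simp
  have hVtop : ∀ y, V y ≠ ∞ := fun y => ne_top_of_le_ne_top (by finiteness) (hVle y)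
  set v : EuclideanSpace ℝ (Fin d) → ℝ≥0 := fun y =>
    (V y / ENNReal.ofReal (phiB φ x r y)).toNNReal with hv
  have hvm : Measurable v := by
    change Measurable fun y => (V y / ENNReal.ofReal (phiB φ x r y)).toNNReal
    fun_prop
  have hvle : ∀ y, V y / ENNReal.ofReal (phiB φ x r y) ≤ ((4 * c₂ ^ 2).toNNReal : ℝ≥0∞) :=
    fun y => ENNReal.div_le_of_le_mul (hVle y)
  have hvcoe : ∀ y, (v y : ℝ≥0∞) = V y / ENNReal.ofReal (phiB φ x r y) := fun y =>
    ENNReal.coe_toNNReal (ne_top_of_le_ne_top coe_ne_top (hvle y))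
  have hvV : ∀ y, ENNReal.ofReal (phiB φ x r y) * v y = V y := fun y => by
    rw [hvcoe]
    refine ENNReal.mul_div_cancel' (fun h0 => ?_) (fun h0 => (ENNReal.ofReal_ne_top h0).elim)
    have := hVle y
    rwa [h0, mul_zero, nonpos_iff_eq_zero] at this
  refine ⟨v, hvm, fun y => ?_, ?_, ?_⟩
  · rw [← ENNReal.coe_le_coe, hvcoe]
    exact hvle y
  · ext s hs
    rw [Measure.map_apply measurable_snd hs, withDensity_apply _ (measurable_snd hs),
      withDensity_apply _ hs, hm, restrict_withDensity hs,
      lintegral_withDensity_eq_lintegral_mul _ (by fun_prop) (by fun_prop),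
      ← lintegral_indicator (measurable_snd hs), ← lintegral_indicator hs,
      hdis _ (Measurable.indicator (by fun_prop) (measurable_snd hs))]
    refine lintegral_congr fun y => ?_
    by_cases hy : y ∈ s
    · simp only [indicator_of_mem hy, Pi.mul_apply, hvV, hV]
      refine lintegral_congr fun u => ?_
      rw [indicator_of_mem (show (u, y) ∈ Prod.snd ⁻¹' s from hy)]
    · rw [indicator_of_notMem hy]
      refine (lintegral_congr fun u => ?_).trans lintegral_zero
      rw [indicator_of_notMem (show (u, y) ∉ Prod.snd ⁻¹' s from hy)]
  · have hpt : ∀ y, ENNReal.ofReal (phiB φ x r y) * ENNReal.ofReal ((v y - 1) ^ 2) ≤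
        ENNReal.ofReal (4 * c₂ ^ 3 / r ^ 2) * ∫⁻ u, edist u y ^ 2 ∂κ y := by
      intro y
      rcases (h.phiB_nonneg (x := x) (r := r) (y := y)).eq_or_lt with h0 | h0
      · rw [← h0]; simp
      have hnm : Measurable fun u => nearWeight φ x r (u, y) := by fun_prop
      have hreal : phiB φ x r y * v y = ∫ u, nearWeight φ x r (u, y) ∂κ y := by
        rw [integral_eq_lintegral_of_nonneg_ae (.of_forall fun u => h.nearWeight_nonneg)
          hnm.aestronglyMeasurable]
        change _ = (V y).toReal
        rw [← hvV, ENNReal.toReal_mul, ENNReal.toReal_ofReal h0.le, ENNReal.coe_toReal]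
      have hint : Integrable (fun u => nearWeight φ x r (u, y)) (κ y) :=
        Integrable.of_bound hnm.aestronglyMeasurable 1 (.of_forall fun u => by
          rw [Real.norm_of_nonneg h.nearWeight_nonneg]; exact h.nearWeight_le_one)
      have hsub : phiB φ x r y * (v y - 1) =
          ∫ u, (nearWeight φ x r (u, y) - phiB φ x r y) ∂κ y := by
        rw [integral_sub hint (integrable_const _), ← hreal]
        simp
        ring
      have hJ : ENNReal.ofReal ((phiB φ x r y * (v y - 1)) ^ 2) ≤
          ∫⁻ u, ENNReal.ofReal ((nearWeight φ x r (u, y) - phiB φ x r y) ^ 2) ∂κ y := by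
        have hsq : ∀ t : ℝ, ENNReal.ofReal (t ^ 2) = ‖t‖ₑ ^ 2 := fun t => by
          rw [← sq_abs, ENNReal.ofReal_pow (abs_nonneg _), ← Real.norm_eq_abs,
            ofReal_norm]
        simp only [hsq]
        rw [hsub]
        calc _ ≤ (∫⁻ u, ‖nearWeight φ x r (u, y) - phiB φ x r y‖ₑ ∂κ y) ^ 2 := by
              gcongr; exact enorm_integral_le_lintegral_enorm _
          _ ≤ _ := by
              refine (sq_lintegral_le _ (by fun_prop)).trans_eq ?_
              rw [measure_univ, one_mul]
      have hψ0 : ENNReal.ofReal (phiB φ x r y) ≠ 0 := (ENNReal.ofReal_pos.2 h0).ne'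
      refine (ENNReal.mul_le_mul_iff_right hψ0 ENNReal.ofReal_ne_top).1 ?_
      calc _ = ENNReal.ofReal ((phiB φ x r y * (v y - 1)) ^ 2) := by
            rw [← ENNReal.ofReal_mul h0.le, ← ENNReal.ofReal_mul h0.le]
            congr 1; ring
        _ ≤ _ := hJ
        _ ≤ ∫⁻ u, (ENNReal.ofReal (phiB φ x r y) * ENNReal.ofReal (4 * c₂ ^ 3 / r ^ 2)) *
              edist u y ^ 2 ∂κ y := by
            refine lintegral_mono fun u => ?_
            rw [edist_dist, ← ENNReal.ofReal_pow dist_nonneg, ← ENNReal.ofReal_mul h0.le,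
              ← ENNReal.ofReal_mul (by positivity)]
            refine ENNReal.ofReal_le_ofReal ((h.sq_nearWeight_sub_le (z := (u, y)) hc₂ hr).trans_eq ?_)
            ring
        _ = _ := by rw [lintegral_const_mul _ (by fun_prop), mul_assoc]
    rw [hm, lintegral_withDensity_eq_lintegral_mul _ (by fun_prop) (by fun_prop)]
    refine (lintegral_mono hpt).trans_eq ?_
    rw [lintegral_const_mul' _ _ ENNReal.ofReal_ne_top, sqCost, hdis _ measurable_edist_sq]

end IsBump

end Truncation

section Localization

variable {d : ℕ} {φ : EuclideanSpace ℝ (Fin d) → ℝ} {c₂ : ℝ} {x : EuclideanSpace ℝ (Fin d)} {r : ℝ}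

namespace IsBump

theorem withDensity_phiB_compl (h : IsBump c₂ φ) (hr : 0 < r)
    (μ : Measure (EuclideanSpace ℝ (Fin d))) :
    (μ.withDensity fun y => ENNReal.ofReal (phiB φ x r y)) (closedBall x (3 * r))ᶜ = 0 := by
  rw [withDensity_apply _ isClosed_closedBall.measurableSet.compl]
  refine (setLIntegral_congr_fun isClosed_closedBall.measurableSet.compl
    fun y hy => ?_).trans lintegral_zero
  simp [h.phiB_eq_zero hr (depth_eq_zero hr hy)]

theorem withDensity_phiB_univ_le (h : IsBump c₂ φ) (μ : Measure (EuclideanSpace ℝ (Fin d))) :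
    (μ.withDensity fun y => ENNReal.ofReal (phiB φ x r y)) univ ≤ μ univ := by
  rw [withDensity_apply _ .univ, Measure.restrict_univ]
  refine (lintegral_mono (g := 1) fun y => ?_).trans_eq (by simp)
  simpa using h.phiB_le_one

theorem measure_closedBall_le (h : IsBump c₂ φ) (hr : 0 < r)
    (μ : Measure (EuclideanSpace ℝ (Fin d))) :
    μ (closedBall x r) ≤ (μ.withDensity fun y => ENNReal.ofReal (phiB φ x r y)) univ := by
  refine le_trans ?_ (measure_mono (subset_univ (closedBall x r)))
  rw [withDensity_apply _ isClosed_closedBall.measurableSet, ← setLIntegral_one]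
  refine setLIntegral_mono' isClosed_closedBall.measurableSet fun y hy => ?_
  simp [h.phiB_eq_one hr hy]

/-- Localization of a coupling: `φ_B μ` is close to a density with respect to `φ_B ν` whose
variance is controlled by the cost of the coupling. -/
theorem exists_density (h : IsBump c₂ φ) (hc₂ : 0 < c₂) (hr : 0 < r)
    (π : Measure (EuclideanSpace ℝ (Fin d) × EuclideanSpace ℝ (Fin d))) [IsFiniteMeasure π]
    {m : Measure (EuclideanSpace ℝ (Fin d))}
    (hm : m = (π.map Prod.snd).withDensity fun y => ENNReal.ofReal (phiB φ x r y)) (hm0 : m ≠ 0) :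
    ∃ (v : EuclideanSpace ℝ (Fin d) → ℝ≥0) (D : ℝ≥0) (t : ℝ), Measurable v ∧ (∀ y, v y ≤ D) ∧
      ((π.map Prod.fst).withDensity fun y => ENNReal.ofReal (phiB φ x r y)) univ =
        ∫⁻ y, v y ∂m ∧
      W2sq ((π.map Prod.fst).withDensity fun y => ENNReal.ofReal (phiB φ x r y))
        (m.withDensity fun y => (v y : ℝ≥0∞)) ≤ ENNReal.ofReal (1 + 144 * c₂) * sqCost π ∧
      ∫⁻ y, ENNReal.ofReal ((v y - t) ^ 2) ∂m ≤
        ENNReal.ofReal (4 * c₂ ^ 3 / r ^ 2) * sqCost π := by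
  obtain ⟨v, hv, hvD, hvm, hvar⟩ := h.exists_density_nearWeight hc₂ hr π hm
  have hψm : Measurable (phiB φ x r) := h.continuous_phiB.measurable
  have hnm : Measurable (nearWeight φ x r) := h.measurable_nearWeight
  have hfm : Measurable (farWeight φ x r) := h.measurable_farWeight
  have hmball : m (closedBall x (3 * r))ᶜ = 0 := hm ▸ h.withDensity_phiB_compl hr _
  have hmuniv : m univ ≠ 0 := by simpa using hm0
  have : IsFiniteMeasure m :=
    ⟨by rw [hm]; exact (h.withDensity_phiB_univ_le _).trans_lt (measure_lt_top _ _)⟩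
  set σg := (π.withDensity fun z => ENNReal.ofReal (nearWeight φ x r z)).map Prod.fst with hσg
  set σb := (π.withDensity fun z => ENNReal.ofReal (farWeight φ x r z)).map Prod.fst with hσb
  have hsum : (π.map Prod.fst).withDensity (fun y => ENNReal.ofReal (phiB φ x r y)) =
      σg + σb := by
    rw [hσg, hσb, ← Measure.map_add _ _ measurable_fst, ← withDensity_add_left (by fun_prop),
      ← map_withDensity_comp _ measurable_fst (by fun_prop)]
    congr 2
    ext z
    exact nearWeight_add_farWeight.symm
  rw [hsum]
  have : IsFiniteMeasure (σg + σb) :=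
    ⟨by rw [← hsum]; exact (h.withDensity_phiB_univ_le _).trans_lt (measure_lt_top _ _)⟩
  have : IsFiniteMeasure σb := isFiniteMeasure_of_le (σg + σb) (Measure.le_add_left le_rfl)
  have hσball : σb (closedBall x (3 * r))ᶜ = 0 := by
    have h1 := h.withDensity_phiB_compl (x := x) hr (π.map Prod.fst)
    rw [hsum, Measure.add_apply, add_eq_zero] at h1
    exact h1.2
  have hcost : σb univ ≤ ENNReal.ofReal (4 * c₂ / r ^ 2) * sqCost π := by
    rw [hσb, Measure.map_apply measurable_fst .univ, preimage_univ, withDensity_apply _ .univ,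
      Measure.restrict_univ, sqCost, ← lintegral_const_mul _ measurable_edist_sq]
    refine lintegral_mono fun z => ?_
    rw [edist_dist, ← ENNReal.ofReal_pow dist_nonneg, ← ENNReal.ofReal_mul (by positivity)]
    exact ENNReal.ofReal_le_ofReal (h.farWeight_le hc₂ hr)
  have hs : σb univ / m univ ≠ ∞ := ENNReal.div_ne_top (measure_ne_top _ _) hmuniv
  set t : ℝ≥0 := (σb univ / m univ).toNNReal with ht
  have htm : (t : ℝ≥0∞) * m univ = σb univ := by
    rw [ht, ENNReal.coe_toNNReal hs, ENNReal.div_mul_cancel hmuniv (measure_ne_top _ _)]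
  have hwd : (m.withDensity fun y => ((v y + t : ℝ≥0) : ℝ≥0∞)) =
      m.withDensity (fun y => (v y : ℝ≥0∞)) + (t : ℝ≥0∞) • m := by
    rw [← withDensity_const, ← withDensity_add_left (by fun_prop)]
    rfl
  have hnear : W2sq σg (m.withDensity fun y => (v y : ℝ≥0∞)) ≤ sqCost π := by
    rw [← hvm]
    refine (W2sq_withDensity_le π (by fun_prop)).trans (lintegral_mono fun z => ?_)
    refine mul_le_of_le_one_left zero_le ?_
    simpa using h.nearWeight_le_one
  have : IsFiniteMeasure ((t : ℝ≥0∞) • m) :=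
    ⟨by rw [Measure.smul_apply, smul_eq_mul]; finiteness⟩
  have hfar : W2sq σb ((t : ℝ≥0∞) • m) ≤ ENNReal.ofReal (144 * c₂) * sqCost π := by
    refine (W2sq_le_of_bounded σb ((t : ℝ≥0∞) • m) (by simp [htm])
      isClosed_closedBall.measurableSet (D := ENNReal.ofReal (6 * r)) (fun y hy z hz => ?_) hσball
      (by simp [hmball])).trans ?_
    · rw [edist_dist]
      refine ENNReal.ofReal_le_ofReal ((dist_triangle_right y z x).trans ?_)
      linarith [mem_closedBall.1 hy, mem_closedBall.1 hz]
    · grw [hcost]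
      rw [← mul_assoc, ← ENNReal.ofReal_pow (by positivity), ← ENNReal.ofReal_mul (by positivity)]
      refine le_of_eq ?_
      congr 2
      field_simp
      norm_num
  refine ⟨fun y => v y + t, (4 * c₂ ^ 2).toNNReal + t, 1 + t, by fun_prop,
    fun y => add_le_add_left (hvD y) t, ?_, ?_, ?_⟩
  · have h1 : (m.withDensity fun y => (v y : ℝ≥0∞)) univ = σg univ := by
      rw [← hvm, hσg, Measure.map_apply measurable_snd .univ, Measure.map_apply measurable_fst .univ]
      simp
    have h2 := congrArg (fun ρ => ρ univ) hwd
    simp only [Measure.add_apply, Measure.smul_apply, smul_eq_mul, htm, h1] at h2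
    rw [Measure.add_apply, ← h2, withDensity_apply _ .univ, Measure.restrict_univ]
  · rw [hwd, ENNReal.ofReal_add zero_le_one (by positivity), add_mul, ENNReal.ofReal_one, one_mul]
    exact (W2sq_add_le _ _ _ _).trans (add_le_add hnear hfar)
  · refine le_trans (le_of_eq ?_) hvar
    refine lintegral_congr fun y => ?_
    push_cast
    congr 2
    ring

/-- The transport estimate for a single coupling. -/
theorem W2sq_phiB_le (h : IsBump c₂ φ) (hc₂ : 0 < c₂) (hr : 0 < r)
    (π : Measure (EuclideanSpace ℝ (Fin d) × EuclideanSpace ℝ (Fin d))) [IsFiniteMeasure π]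
    {m : Measure (EuclideanSpace ℝ (Fin d))}
    (hm : m = (π.map Prod.snd).withDensity fun y => ENNReal.ofReal (phiB φ x r y))
    {M : Measure (EuclideanSpace ℝ (Fin d))} [IsProbabilityMeasure M] {K a b R : ℝ≥0}
    (hM : ChiSqTransport M (ENNReal.ofReal (r ^ 2) * K)) (ha : a ≠ 0) (hR : R ≠ 0)
    (ham : ((R : ℝ≥0∞) * a) • M ≤ m) (hmb : m ≤ ((R : ℝ≥0∞) * b) • M) {c : ℝ≥0} (hc : c ≠ 0)
    (hmass : ((π.map Prod.fst).withDensity fun y => ENNReal.ofReal (phiB φ x r y)) univ =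
      c * m univ) :
    W2sq ((π.map Prod.fst).withDensity fun y => ENNReal.ofReal (phiB φ x r y))
      ((c : ℝ≥0∞) • m) ≤
    (3 / 2 * ENNReal.ofReal (1 + 144 * c₂) +
      3 * (18 * K * (b / a) * (c : ℝ≥0∞)⁻¹ * ENNReal.ofReal (4 * c₂ ^ 3))) * sqCost π := by
  have ha' : (a : ℝ≥0∞) ≠ 0 := by simpa using ha
  have hR' : (R : ℝ≥0∞) ≠ 0 := by simpa using hR
  have hm0 : m ≠ 0 := by
    rintro rfl
    have h1 := ham univ
    simp [ha, hR] at h1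
  have hmball : m (closedBall x (3 * r))ᶜ = 0 := hm ▸ h.withDensity_phiB_compl hr _
  have : IsFiniteMeasure m :=
    ⟨by rw [hm]; exact (h.withDensity_phiB_univ_le _).trans_lt (measure_lt_top _ _)⟩
  obtain ⟨v, D, t, hv, hvD, hvm, hcost, hvar⟩ := h.exists_density hc₂ hr π hm hm0
  have hmass' : ∫⁻ y, v y ∂m = c * m univ := by rw [← hvm, hmass]
  have hwu : (m.withDensity fun y => (v y : ℝ≥0∞)) univ = c * m univ := by
    rw [withDensity_apply _ .univ, Measure.restrict_univ, hmass']
  have : IsFiniteMeasure (m.withDensity fun y => (v y : ℝ≥0∞)) :=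
    ⟨by rw [hwu]; finiteness⟩
  have : IsFiniteMeasure ((π.map Prod.fst).withDensity fun y => ENNReal.ofReal (phiB φ x r y)) :=
    ⟨by rw [hmass]; finiteness⟩
  have : IsFiniteMeasure ((c : ℝ≥0∞) • m) :=
    ⟨by rw [Measure.smul_apply, smul_eq_mul]; finiteness⟩
  have hfin : W2sq (m.withDensity fun y => (v y : ℝ≥0∞)) ((c : ℝ≥0∞) • m) ≠ ∞ := by
    refine ne_top_of_le_ne_top ?_ (W2sq_le_of_bounded _ _ (by simp [hwu])
      isClosed_closedBall.measurableSet (D := ENNReal.ofReal (6 * r)) (fun y hy z hz => ?_)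
      (withDensity_absolutelyContinuous _ _ hmball) (by simp [hmball]))
    · rw [hwu]; finiteness
    · rw [edist_dist]
      refine ENNReal.ofReal_le_ofReal ((dist_triangle_right y z x).trans ?_)
      linarith [mem_closedBall.1 hy, mem_closedBall.1 hz]
  have hvtr := hM.W2sq_withDensity_le (a := R * a) (b := R * b) (mul_ne_zero hR ha)
    (by rwa [ENNReal.coe_mul]) (by rwa [ENNReal.coe_mul]) hv hvD hc hmass' hfin t
  refine (W2sq_triangle _ _ _).trans ((add_le_add (mul_le_mul_right hcost _)
    (mul_le_mul_right (hvtr.trans (mul_le_mul_right hvar _)) _)).trans_eq ?_)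
  have hrr : ENNReal.ofReal (4 * c₂ ^ 3) =
      ENNReal.ofReal (r ^ 2) * ENNReal.ofReal (4 * c₂ ^ 3 / r ^ 2) := by
    rw [← ENNReal.ofReal_mul (by positivity)]
    congr 1
    field_simp
  rw [hrr, ENNReal.coe_mul, ENNReal.coe_mul, ENNReal.mul_div_mul_left _ _ hR' ENNReal.coe_ne_top]
  ring

end IsBump

end Localization

/-- The function `f` is invisible after multiplication by `φ_B`. -/
theorem bumpMeasure_eq_withDensity {d : ℕ} (n : ℕ) {φ : EuclideanSpace ℝ (Fin d) → ℝ} {c₂ : ℝ}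
    (h : IsBump c₂ φ) {x : EuclideanSpace ℝ (Fin d)} {r : ℝ} (hr : 0 < r)
    {L : AffineSubspace ℝ (EuclideanSpace ℝ (Fin d))} {f : EuclideanSpace ℝ (Fin d) → ℝ}
    (hf : AEMeasurable f ((μH[(n:ℝ)]).restrict (L : Set (EuclideanSpace ℝ (Fin d)))))
    (hf1 : ∀ y ∈ (L : Set (EuclideanSpace ℝ (Fin d))) ∩ closedBall x (3 * r), f y = 1) :
    bumpMeasure n φ x r L =
      (((μH[(n:ℝ)]).restrict (L : Set (EuclideanSpace ℝ (Fin d)))).withDensity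
        fun y => ENNReal.ofReal (f y)).withDensity fun y => ENNReal.ofReal (phiB φ x r y) := by
  have hψm : Measurable (phiB φ x r) := h.continuous_phiB.measurable
  rw [← withDensity_mul₀ hf.ennreal_ofReal (by fun_prop), bumpMeasure]
  refine withDensity_congr_ae ?_
  filter_upwards [ae_restrict_mem L.closed_of_finiteDimensional.measurableSet] with y hy
  by_cases hyB : y ∈ closedBall x (3 * r)
  · simp [hf1 y ⟨hy, hyB⟩]
  · simp [h.phiB_eq_zero hr (depth_eq_zero hr hyB)]

theorem ofReal_cBL {d : ℕ} (n : ℕ) {φ : EuclideanSpace ℝ (Fin d) → ℝ} {c₂ : ℝ}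
    (h : IsBump c₂ φ) {x : EuclideanSpace ℝ (Fin d)} {r : ℝ}
    {L : AffineSubspace ℝ (EuclideanSpace ℝ (Fin d))}
    (μ : Measure (EuclideanSpace ℝ (Fin d))) [IsFiniteMeasure μ]
    (h0 : bumpMeasure n φ x r L univ ≠ 0) (htop : bumpMeasure n φ x r L univ ≠ ∞) :
    ENNReal.ofReal (cBL n φ μ x r L) =
      (μ.withDensity fun y => ENNReal.ofReal (phiB φ x r y)) univ / bumpMeasure n φ x r L univ := by
  have hψm : Measurable (phiB φ x r) := h.continuous_phiB.measurable
  have key : ∀ ρ : Measure (EuclideanSpace ℝ (Fin d)), ∫ y, phiB φ x r y ∂ρ =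
      ((ρ.withDensity fun y => ENNReal.ofReal (phiB φ x r y)) univ).toReal := fun ρ => by
    rw [integral_eq_lintegral_of_nonneg_ae (.of_forall fun u => h.phiB_nonneg)
      hψm.aestronglyMeasurable, withDensity_apply _ .univ, Measure.restrict_univ]
  rw [cBL, key, key, ← bumpMeasure, ENNReal.ofReal_div_of_pos (ENNReal.toReal_pos h0 htop),
    ENNReal.ofReal_toReal htop, ENNReal.ofReal_toReal]
  exact ne_top_of_le_ne_top (measure_ne_top μ _) (h.withDensity_phiB_univ_le μ)

/-- Lemma 5.3.
Let `μ` be supported on a ball `B'`, `B` a ball with `3B ⊆ B'`, comparable radii, and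
`μ(B) ≈ μ(B') ≈ r(B)ⁿ`. If `L` is an `n`-plane meeting `B` and `f : L → [0,1]` equals `1`
on `3B ∩ L`, vanishes on `L∖B'` and `∫f dℋⁿ⌊L = μ(B')`, then
`W₂(φ_B μ, c φ_B ℋⁿ⌊L) ≤ C' W₂(μ, f ℋⁿ⌊L)`. -/
theorem statement14 (n d : ℕ) (hnd : n ≤ d) (C c₂ : ℝ) (hC : 0 < C) (hc₂ : 0 < c₂) :
    ∃ C' : ℝ, 0 < C' ∧
      ∀ φ : EuclideanSpace ℝ (Fin d) → ℝ, IsBump c₂ φ →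
      ∀ μ : Measure (EuclideanSpace ℝ (Fin d)), IsFiniteMeasure μ →
      ∀ (x' : EuclideanSpace ℝ (Fin d)) (r' : ℝ) (x : EuclideanSpace ℝ (Fin d)) (r : ℝ),
        0 < r →
        μ ((closedBall x' r')ᶜ) = 0 →
        closedBall x (3 * r) ⊆ closedBall x' r' →
        C⁻¹ * r' ≤ r → r ≤ r' →
        ENNReal.ofReal (C⁻¹ * r ^ n) ≤ μ (closedBall x r) →
        μ (closedBall x' r') ≤ ENNReal.ofReal (C * r ^ n) →
      ∀ L : AffineSubspace ℝ (EuclideanSpace ℝ (Fin d)),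
        Module.finrank ℝ L.direction = n →
        ((L : Set (EuclideanSpace ℝ (Fin d))) ∩ closedBall x r).Nonempty →
      ∀ f : EuclideanSpace ℝ (Fin d) → ℝ,
        (∀ y ∈ (L : Set (EuclideanSpace ℝ (Fin d))), f y ∈ Icc (0:ℝ) 1) →
        (∀ y ∈ (L : Set (EuclideanSpace ℝ (Fin d))) ∩ closedBall x (3 * r), f y = 1) →
        (∀ y ∈ (L : Set (EuclideanSpace ℝ (Fin d))) \ closedBall x' r', f y = 0) →
        (∫ y, f y ∂((μH[(n:ℝ)]).restrict (L : Set (EuclideanSpace ℝ (Fin d))))) =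
          (μ (closedBall x' r')).toReal →
      Wp 2 (μ.withDensity fun y => ENNReal.ofReal (phiB φ x r y)) (flatB n φ μ x r L) ≤
        ENNReal.ofReal C' *
          Wp 2 μ (((μH[(n:ℝ)]).restrict (L : Set (EuclideanSpace ℝ (Fin d)))).withDensity
            (fun y => ENNReal.ofReal (f y))) := by
  obtain ⟨K, a, b, ha, hKab⟩ := exists_chiSqTransport_bumpMeasure n hc₂
  set Q : ℝ := 3 / 2 * (1 + 144 * c₂) + 3 * (18 * K * (b / a) * (b * C) * (4 * c₂ ^ 3)) with hQ
  have hQpos : 0 < Q := by positivity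
  refine ⟨√Q, Real.sqrt_pos.2 hQpos, ?_⟩
  intro φ hφ μ hμ x' r' x r hr hsupp hsub _ _ hlow hup L hL hne f hf hf1 hf0 hint
  have hrn : 0 < r ^ n := pow_pos hr n
  obtain ⟨M, hMp, hM, ham, hmb⟩ := hKab d φ hφ x r hr L hL hne
  have hxx : closedBall x r ⊆ closedBall x' r' :=
    (closedBall_subset_closedBall (by linarith)).trans hsub
  have hμpos : 0 < μ (closedBall x r) := lt_of_lt_of_le (by simpa using by positivity) hlow
  have hfm : AEMeasurable f ((μH[(n:ℝ)]).restrict (L : Set (EuclideanSpace ℝ (Fin d)))) := by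
    by_contra hcon
    rw [integral_undef fun hi => hcon hi.aemeasurable] at hint
    exact (ENNReal.toReal_pos (hμpos.trans_le (measure_mono hxx)).ne' (measure_ne_top _ _)).ne hint
  have hm0 : bumpMeasure n φ x r L univ ≠ 0 := fun h0 => by
    have h1 := ham univ
    rw [h0, Measure.smul_apply, measure_univ] at h1
    simp [ha, hrn.not_ge] at h1
  have hmle : bumpMeasure n φ x r L univ ≤ ENNReal.ofReal (r ^ n) * b := by
    simpa using hmb univ
  have hmtop : bumpMeasure n φ x r L univ ≠ ∞ := ne_top_of_le_ne_top (by finiteness) hmle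
  have hc := ofReal_cBL n hφ (x := x) (r := r) (L := L) μ hm0 hmtop
  set P := (μ.withDensity fun y => ENNReal.ofReal (phiB φ x r y)) univ with hP
  have hPlow : ENNReal.ofReal (C⁻¹ * r ^ n) ≤ P := hlow.trans (hφ.measure_closedBall_le hr μ)
  have hP0 : P ≠ 0 := (hμpos.trans_le (hφ.measure_closedBall_le hr μ)).ne'
  have hPtop : P ≠ ∞ := ne_top_of_le_ne_top (measure_ne_top μ _) (hφ.withDensity_phiB_univ_le μ)
  have hcinv : (ENNReal.ofReal (cBL n φ μ x r L))⁻¹ ≤ ENNReal.ofReal (b * C) := by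
    rw [hc, ENNReal.inv_div (.inl hmtop) (.inl hm0)]
    refine ENNReal.div_le_of_le_mul (hmle.trans ?_)
    grw [← hPlow]
    rw [← ENNReal.ofReal_coe_nnreal, ← ENNReal.ofReal_mul (by positivity),
      ← ENNReal.ofReal_mul (by positivity)]
    refine ENNReal.ofReal_le_ofReal (le_of_eq ?_)
    field_simp
  refine Wp_two_le_of_forall_coupling hQpos fun π hπ => ?_
  have : IsFiniteMeasure π := hπ.isFiniteMeasure
  have hmeq : bumpMeasure n φ x r L =
      (π.map Prod.snd).withDensity fun y => ENNReal.ofReal (phiB φ x r y) := by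
    rw [hπ.snd]
    exact bumpMeasure_eq_withDensity n hφ hr hfm hf1
  have main := hφ.W2sq_phiB_le hc₂ hr π hmeq hM ha (R := (r ^ n).toNNReal)
    (by simpa using hrn) ham hmb (c := (cBL n φ μ x r L).toNNReal)
    (fun h0 => by
      have : ENNReal.ofReal (cBL n φ μ x r L) = 0 := by simpa using h0
      rw [hc] at this
      simp [hP0, hmtop] at this)
    (by
      rw [hπ.fst]
      change P = ENNReal.ofReal (cBL n φ μ x r L) * _
      rw [hc, ENNReal.div_mul_cancel hm0 hmtop])
  rw [hπ.fst] at main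
  refine main.trans (mul_le_mul_left ?_ _)
  calc _ ≤ 3 / 2 * ENNReal.ofReal (1 + 144 * c₂) +
        3 * (18 * K * (b / a) * ENNReal.ofReal (b * C) * ENNReal.ofReal (4 * c₂ ^ 3)) := by
        gcongr
        exact hcinv
    _ = ENNReal.ofReal Q := by
        rw [hQ, ENNReal.ofReal_add (p := 3 / 2 * _) (by positivity) (by positivity),
          ENNReal.ofReal_mul (p := 3 / 2) (by positivity), ENNReal.ofReal_mul (p := 3) (by positivity),
          ENNReal.ofReal_mul (p := 18 * K * (b / a) * (b * C)) (by positivity),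
          ENNReal.ofReal_mul (p := 18 * K * (b / a)) (by positivity),
          ENNReal.ofReal_mul (p := 18 * K) (by positivity),
          ENNReal.ofReal_mul (p := 18) (by positivity),
          ENNReal.ofReal_div_of_pos (by norm_num), ENNReal.ofReal_div_of_pos (by positivity)]
        simp only [ENNReal.ofReal_coe_nnreal, ENNReal.ofReal_ofNat]
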